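/- arXiv:1310.7164 — 17 statements merged into one kernel-verified Lean document; each statement's English description precedes it below -/
import Mathlib

section
/- For all a > 0 and c > 0, (1/2)·∫₀^∞ e^{−t/2} ( ∫₀^∞ ∫₀^∞ √(2/(π t³))·x^a·l^c·(x+l)·exp(−(x+l)²/(2t)) dx dl ) dt = Γ(1+a)·Γ(1+c), where Γ is the classical gamma function. (Equivalently: if (X, L) is a pair of random variables whose law, after subordination by an independent exponential time 2𝓔 of mean 2, has density (x,l) ↦ (1/2)∫₀^∞ e^{−t/2}√(2/(π t³))(x+l)e^{−(x+l)²/(2t)} dt on (0,∞)², then X and L are two independent standard exponential variables.) -/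
open MeasureTheory Set

theorem integrableOn_rpow_mul_one_add_rpow {a c : ℝ} (ha : 0 ≤ a) (hc : 0 < c) :
    IntegrableOn (fun y : ℝ => y ^ a * (1 + y) ^ (-(a + c + 2))) (Ioi 0) := by
  have h : IntegrableOn (fun y : ℝ => (y + 1) ^ (-(c + 2))) (Ioi 0) :=
    integrableOn_add_rpow_Ioi_of_lt (by linarith) (by norm_num)
  refine h.mono' (by fun_prop) ?_
  filter_upwards [self_mem_ae_restrict measurableSet_Ioi] with y hy
  have hy0 : 0 < y := hy
  rw [Real.norm_of_nonneg (by positivity)]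
  calc y ^ a * (1 + y) ^ (-(a + c + 2)) ≤ (1 + y) ^ a * (1 + y) ^ (-(a + c + 2)) := by
        gcongr
        linarith
    _ = (y + 1) ^ (-(c + 2)) := by
        rw [← Real.rpow_add (by positivity), add_comm y 1]
        congr 1
        ring

theorem integral_integral_rpow_mul_rpow_mul_comp_add {a c : ℝ} (ha : 0 ≤ a) (hc : 0 < c)
    {h : ℝ → ℝ} (hm : Measurable h)
    (hi : IntegrableOn (fun s : ℝ => s ^ (a + c + 1) * h s) (Ioi 0)) :
    ∫ l in Ioi (0:ℝ), ∫ x in Ioi (0:ℝ), x ^ a * l ^ c * h (x + l) =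
      (∫ y in Ioi (0:ℝ), y ^ a * (1 + y) ^ (-(a + c + 2))) *
        ∫ s in Ioi (0:ℝ), s ^ (a + c + 1) * h s := by
  set g : ℝ → ℝ := fun s => s ^ (a + c + 1) * h s with hg
  have hgm : Measurable g := by fun_prop
  have hinner : ∀ l ∈ Ioi (0:ℝ), ∫ x in Ioi (0:ℝ), x ^ a * l ^ c * h (x + l) =
      ∫ y in Ioi (0:ℝ), y ^ a * (1 + y) ^ (-(a + c + 1)) * g ((1 + y) * l) := by
    intro l hl
    have hl0 : 0 < l := hl
    have hsub := integral_comp_mul_left_Ioi (fun x : ℝ => x ^ a * l ^ c * h (x + l)) 0 hl0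
    rw [mul_zero, smul_eq_mul, eq_inv_mul_iff_mul_eq₀ hl0.ne', ← integral_const_mul] at hsub
    rw [← hsub]
    refine setIntegral_congr_fun measurableSet_Ioi fun y hy => ?_
    have hy0 : 0 < y := hy
    have hy1 : 0 < 1 + y := by linarith
    simp only [hg]
    rw [Real.mul_rpow hl0.le hy0.le, Real.mul_rpow hy1.le hl0.le, Real.rpow_neg hy1.le,
      Real.rpow_add hl0, Real.rpow_add hl0, Real.rpow_one,
      show l * y + l = (1 + y) * l by ring]
    have := (Real.rpow_pos_of_pos hy1 (a + c + 1)).ne'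
    field_simp
  have hscale (k : ℝ → ℝ) : ∀ y ∈ Ioi (0:ℝ),
      ∫ l in Ioi (0:ℝ), y ^ a * (1 + y) ^ (-(a + c + 1)) * k ((1 + y) * l) =
        y ^ a * (1 + y) ^ (-(a + c + 2)) * ∫ s in Ioi (0:ℝ), k s := by
    intro y hy
    have hy1 : 0 < 1 + y := by linarith [show 0 < y from hy]
    rw [integral_const_mul, integral_comp_mul_left_Ioi k 0 hy1, mul_zero, smul_eq_mul,
      show -(a + c + 2) = -(a + c + 1) + -1 by ring, Real.rpow_add hy1, Real.rpow_neg_one]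
    ring
  have hint : Integrable
      (Function.uncurry fun y l : ℝ => y ^ a * (1 + y) ^ (-(a + c + 1)) * g ((1 + y) * l))
      ((volume.restrict (Ioi 0)).prod (volume.restrict (Ioi 0))) := by
    refine (integrable_prod_iff ?_).2 ⟨?_, ?_⟩
    · apply Measurable.aestronglyMeasurable
      unfold Function.uncurry
      fun_prop
    · filter_upwards [self_mem_ae_restrict measurableSet_Ioi] with y hy
      have hy1 : 0 < 1 + y := by linarith [show 0 < y from hy]
      have hgy := (integrableOn_Ioi_comp_mul_left_iff g 0 hy1).2 (by simpa using hi)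
      exact Integrable.const_mul hgy (y ^ a * (1 + y) ^ (-(a + c + 1)))
    · refine IntegrableOn.congr_fun ((integrableOn_rpow_mul_one_add_rpow ha hc).mul_const
        (∫ s in Ioi (0:ℝ), ‖g s‖)) (fun y hy => ?_) measurableSet_Ioi
      have hy0 : 0 < y := hy
      simp only [Function.uncurry]
      rw [← hscale (fun s => ‖g s‖) y hy]
      refine integral_congr_ae (.of_forall fun l => ?_)
      simp only [norm_mul]
      rw [Real.norm_of_nonneg (by positivity : 0 ≤ y ^ a),
        Real.norm_of_nonneg (by positivity : 0 ≤ (1 + y) ^ (-(a + c + 1)))]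
  rw [setIntegral_congr_fun measurableSet_Ioi hinner, ← integral_integral_swap hint,
    setIntegral_congr_fun measurableSet_Ioi (hscale g), integral_mul_const]

theorem Gamma_mul_Gamma_eq_integral_mul_Gamma {a c : ℝ} (ha : 0 ≤ a) (hc : 0 < c) :
    Real.Gamma (1 + a) * Real.Gamma (1 + c) =
      (∫ y in Ioi (0:ℝ), y ^ a * (1 + y) ^ (-(a + c + 2))) * Real.Gamma (a + c + 2) := by
  have hG : ∀ p : ℝ, 0 ≤ p → ∫ s in Ioi (0:ℝ), s ^ p * Real.exp (-s) = Real.Gamma (p + 1) := by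
    intro p hp
    rw [Real.Gamma_eq_integral (by linarith)]
    simp only [add_sub_cancel_right, mul_comm]
  have hi : IntegrableOn (fun s : ℝ => s ^ (a + c + 1) * Real.exp (-s)) (Ioi 0) := by
    have := Real.GammaIntegral_convergent (s := a + c + 1 + 1) (by linarith)
    simpa only [add_sub_cancel_right, mul_comm] using this
  have key := integral_integral_rpow_mul_rpow_mul_comp_add ha hc
    (h := fun s => Real.exp (-s)) (by fun_prop) hi
  rw [hG _ (by linarith), show a + c + 1 + 1 = a + c + 2 by ring] at key
  rw [← key, add_comm 1 a, add_comm 1 c, ← hG a ha, ← hG c hc.le, ← integral_const_mul]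
  refine integral_congr_ae (.of_forall fun l => ?_)
  simp only
  rw [← integral_mul_const]
  refine integral_congr_ae (.of_forall fun x => ?_)
  simp only
  rw [neg_add, Real.exp_add]
  ring

theorem mellin_abs_BM_localtime_at_exponential_time (a c : ℝ) (ha : 0 < a) (hc : 0 < c) :
    (1 / 2) * ∫ t in Ioi (0:ℝ), Real.exp (-t / 2) *
        (∫ l in Ioi (0:ℝ), ∫ x in Ioi (0:ℝ),
          Real.sqrt (2 / (Real.pi * t ^ 3)) * x ^ a * l ^ c * (x + l) *
            Real.exp (-(x + l) ^ 2 / (2 * t)))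
      = Real.Gamma (1 + a) * Real.Gamma (1 + c) := by
  set C : ℝ := ∫ y in Ioi (0:ℝ), y ^ a * (1 + y) ^ (-(a + c + 2)) with hC
  set σ : ℝ := (a + c + 2) / 2 with hσ
  have hσ0 : 0 < σ := by positivity
  have hspace : ∀ t ∈ Ioi (0:ℝ), Real.exp (-t / 2) *
        (∫ l in Ioi (0:ℝ), ∫ x in Ioi (0:ℝ),
          Real.sqrt (2 / (Real.pi * t ^ 3)) * x ^ a * l ^ c * (x + l) *
            Real.exp (-(x + l) ^ 2 / (2 * t))) =
      (C * Real.Gamma (σ + 1 / 2) * 2 ^ σ / √Real.pi) *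
        (t ^ (σ - 1) * Real.exp (-(1 / 2 * t))) := by
    intro t ht
    have ht0 : 0 < t := ht
    have hb : 0 < (2 * t)⁻¹ := by positivity
    have hpt : ∀ s ∈ Ioi (0:ℝ), s ^ (a + c + 2) * Real.exp (-(2 * t)⁻¹ * s ^ (2:ℝ)) =
        s ^ (a + c + 1) * (s * Real.exp (-s ^ 2 / (2 * t))) := by
      intro s hs
      have hs0 : 0 < s := hs
      rw [show a + c + 2 = a + c + 1 + 1 by ring, Real.rpow_add_one hs0.ne', Real.rpow_two,
        mul_assoc]
      congr 3
      field_simp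
    have hi : IntegrableOn (fun s : ℝ => s ^ (a + c + 1) * (s * Real.exp (-s ^ 2 / (2 * t))))
        (Ioi 0) :=
      (integrableOn_rpow_mul_exp_neg_mul_rpow (p := 2) (s := a + c + 2) (by linarith)
        (by norm_num) hb).congr_fun hpt measurableSet_Ioi
    have key := integral_integral_rpow_mul_rpow_mul_comp_add ha.le hc
      (h := fun s => s * Real.exp (-s ^ 2 / (2 * t))) (by fun_prop) hi
    rw [← setIntegral_congr_fun measurableSet_Ioi hpt,
      integral_rpow_mul_exp_neg_mul_rpow (by norm_num) (by linarith) hb, ← hC,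
      show -(a + c + 2 + 1) / 2 = -(σ + 1 / 2) by rw [hσ]; ring,
      show (a + c + 2 + 1) / 2 = σ + 1 / 2 by rw [hσ]; ring,
      Real.inv_rpow (by positivity), Real.rpow_neg (by positivity), inv_inv,
      Real.mul_rpow (by norm_num) ht0.le] at key
    have hfac : ∀ l x : ℝ, Real.sqrt (2 / (Real.pi * t ^ 3)) * x ^ a * l ^ c * (x + l) *
        Real.exp (-(x + l) ^ 2 / (2 * t)) = Real.sqrt (2 / (Real.pi * t ^ 3)) *
          (x ^ a * l ^ c * ((x + l) * Real.exp (-(x + l) ^ 2 / (2 * t)))) :=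
      fun l x => by ring
    simp only [hfac, integral_const_mul]
    rw [key]
    have hsq : Real.sqrt (2 / (Real.pi * t ^ 3)) = √2 / (√Real.pi * (t * √t)) := by
      rw [Real.sqrt_div (by norm_num), Real.sqrt_mul Real.pi_pos.le,
        show t ^ 3 = t ^ 2 * t by ring, Real.sqrt_mul (by positivity), Real.sqrt_sq ht0.le]
    have h2 : (2:ℝ) ^ (σ + 1 / 2) = 2 ^ σ * √2 := by
      rw [Real.rpow_add (by norm_num), Real.sqrt_eq_rpow]
    have ht2 : t ^ (σ + 1 / 2) = t ^ (σ - 1) * (t * √t) := by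
      rw [Real.sqrt_eq_rpow, ← mul_assoc, ← Real.rpow_add_one ht0.ne', sub_add_cancel,
        Real.rpow_add ht0]
    have hs2 : √2 * √2 = (2:ℝ) := Real.mul_self_sqrt (by norm_num)
    have hpi : √Real.pi ≠ 0 := by positivity
    have hst : √t ≠ 0 := by positivity
    rw [hsq, h2, ht2, show -t / 2 = -(1 / 2 * t) by ring]
    field_simp
    linear_combination C * hs2
  rw [setIntegral_congr_fun measurableSet_Ioi hspace, integral_const_mul,
    Real.integral_rpow_mul_exp_neg_mul_Ioi hσ0 (by norm_num : (0:ℝ) < 1 / 2),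
    Gamma_mul_Gamma_eq_integral_mul_Gamma ha.le hc, ← hC]
  have hdup := Real.Gamma_mul_Gamma_add_half σ
  rw [show 2 * σ = a + c + 2 by rw [hσ]; ring] at hdup
  have hpow : (2:ℝ) ^ (1 - (a + c + 2)) * (2 ^ σ * 2 ^ σ) = 2 := by
    rw [← Real.rpow_add (by norm_num), ← Real.rpow_add (by norm_num)]
    rw [show 1 - (a + c + 2) + (σ + σ) = 1 by rw [hσ]; ring, Real.rpow_one]
  have hpi : √Real.pi ≠ 0 := by positivity
  rw [one_div_one_div]
  calc 1 / 2 * (C * Real.Gamma (σ + 1 / 2) * 2 ^ σ / √Real.pi * (2 ^ σ * Real.Gamma σ))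
      = 1 / 2 * C * (2 ^ σ * 2 ^ σ) / √Real.pi * (Real.Gamma σ * Real.Gamma (σ + 1 / 2)) := by
        ring
    _ = 1 / 2 * C * Real.Gamma (a + c + 2) * (2 ^ (1 - (a + c + 2)) * (2 ^ σ * 2 ^ σ)) := by
        rw [hdup]
        field_simp
    _ = C * Real.Gamma (a + c + 2) := by
        rw [hpow]
        ring
end

section
/- For all a > 0 and c > 0, one has (2/√(2π))·∫₀^∞ ∫₀^∞ x^a·l^c·(x+l)·exp(−(x+l)²/2) dx dl = Γ(1+a)·Γ(1+c) / (2^{(a+c)/2}·Γ(1+(a+c)/2)), where Γ is the classical gamma function. -/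
open MeasureTheory Set

lemma lintegral_Ioi_eq_lintegral_comp_mul_left {k : ℝ} (hk : 0 < k) (f : ℝ → ENNReal) :
    ∫⁻ x in Ioi (0 : ℝ), f x = ∫⁻ x in Ioi (0 : ℝ), ENNReal.ofReal k * f (k * x) := by
  have h := lintegral_image_eq_lintegral_abs_deriv_mul (s := Ioi (0 : ℝ)) (f := fun x => k * x)
    (f' := fun _ => k) measurableSet_Ioi
    (fun x _ => by simpa using ((hasDerivAt_id x).const_mul k).hasDerivWithinAt)
    (mul_right_injective₀ hk.ne').injOn f
  rwa [image_mul_left_Ioi hk, mul_zero, abs_of_pos hk] at h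

/-- The beta integral of the second kind factors out of the integral over the open quadrant of
`x ^ a * l ^ c` times a function of `x + l`. -/
lemma lintegral_rpow_mul_rpow_mul_comp_add (a c : ℝ) {φ : ℝ → ENNReal} (hφ : Measurable φ) :
    ∫⁻ l in Ioi (0 : ℝ), ∫⁻ x in Ioi (0 : ℝ), ENNReal.ofReal (x ^ a * l ^ c) * φ (x + l) =
      (∫⁻ u in Ioi (0 : ℝ), ENNReal.ofReal (u ^ a * (1 + u) ^ (-(a + c + 2)))) *
        ∫⁻ s in Ioi (0 : ℝ), ENNReal.ofReal (s ^ (a + c + 1)) * φ s := by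
  calc
    _ = ∫⁻ l in Ioi (0 : ℝ), ∫⁻ u in Ioi (0 : ℝ),
          ENNReal.ofReal (u ^ a * l ^ (a + c + 1)) * φ (l * u + l) := by
      refine setLIntegral_congr_fun measurableSet_Ioi fun l (hl : 0 < l) => ?_
      rw [lintegral_Ioi_eq_lintegral_comp_mul_left hl]
      refine setLIntegral_congr_fun measurableSet_Ioi fun u (hu : 0 < u) => ?_
      rw [← mul_assoc, ← ENNReal.ofReal_mul hl.le]
      congr 2
      rw [Real.mul_rpow hl.le hu.le, Real.rpow_add hl, Real.rpow_add hl, Real.rpow_one]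
      ring
    _ = ∫⁻ u in Ioi (0 : ℝ), ∫⁻ l in Ioi (0 : ℝ),
          ENNReal.ofReal (u ^ a * l ^ (a + c + 1)) * φ (l * u + l) :=
      lintegral_lintegral_swap (by fun_prop)
    _ = ∫⁻ u in Ioi (0 : ℝ), ENNReal.ofReal (u ^ a * (1 + u) ^ (-(a + c + 2))) *
          ∫⁻ s in Ioi (0 : ℝ), ENNReal.ofReal (s ^ (a + c + 1)) * φ s := by
      refine setLIntegral_congr_fun measurableSet_Ioi fun u (hu : 0 < u) => ?_
      have hu' : 0 < 1 + u := by positivity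
      rw [lintegral_Ioi_eq_lintegral_comp_mul_left hu' fun s => _ * φ s,
        ← lintegral_const_mul _ (by fun_prop)]
      refine setLIntegral_congr_fun measurableSet_Ioi fun l (hl : 0 < l) => ?_
      rw [← mul_assoc (ENNReal.ofReal (1 + u)), ← mul_assoc, ← ENNReal.ofReal_mul hu'.le,
        ← ENNReal.ofReal_mul (by positivity), show l * u + l = (1 + u) * l by ring]
      congr 2
      have h : (1 + u) ^ (-(a + c + 2)) * ((1 + u) * (1 + u) ^ (a + c + 1)) = 1 := by
        rw [mul_comm (1 + u), ← Real.rpow_add_one hu'.ne', ← Real.rpow_add hu',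
          show -(a + c + 2) + (a + c + 1 + 1) = 0 by ring, Real.rpow_zero]
      rw [Real.mul_rpow hu'.le hl.le]
      linear_combination (-(u ^ a * l ^ (a + c + 1))) * h
    _ = _ := lintegral_mul_const _ (by fun_prop)

lemma lintegral_rpow_mul_exp_neg {a : ℝ} (ha : -1 < a) :
    ∫⁻ x in Ioi (0 : ℝ), ENNReal.ofReal (x ^ a * Real.exp (-x)) =
      ENNReal.ofReal (Real.Gamma (1 + a)) := by
  have h := Real.GammaIntegral_convergent (show 0 < 1 + a by linarith)
  rw [Real.Gamma_eq_integral (by linarith), ofReal_integral_eq_lintegral_ofReal h]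
  · refine lintegral_congr fun x => ?_
    rw [add_sub_cancel_left, mul_comm]
  · filter_upwards [ae_restrict_mem measurableSet_Ioi] with x (hx : 0 < x)
    positivity

lemma lintegral_rpow_mul_one_add_rpow {a c : ℝ} (ha : -1 < a) (hc : -1 < c) :
    ∫⁻ u in Ioi (0 : ℝ), ENNReal.ofReal (u ^ a * (1 + u) ^ (-(a + c + 2))) =
      ENNReal.ofReal (Real.Gamma (1 + a) * Real.Gamma (1 + c) / Real.Gamma (a + c + 2)) := by
  have h := lintegral_rpow_mul_rpow_mul_comp_add a c
    (φ := fun s => ENNReal.ofReal (Real.exp (-s))) (by fun_prop)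
  have hΓ : 0 < Real.Gamma (a + c + 2) := Real.Gamma_pos_of_pos (by linarith)
  have hΓa : 0 < Real.Gamma (1 + a) := Real.Gamma_pos_of_pos (by linarith)
  have hright : ∫⁻ s in Ioi (0 : ℝ), ENNReal.ofReal (s ^ (a + c + 1)) *
      ENNReal.ofReal (Real.exp (-s)) = ENNReal.ofReal (Real.Gamma (a + c + 2)) := by
    rw [show a + c + 2 = 1 + (a + c + 1) by ring, ← lintegral_rpow_mul_exp_neg (by linarith)]
    exact lintegral_congr fun s => (ENNReal.ofReal_mul' (Real.exp_pos _).le).symm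
  have hleft : ∫⁻ l in Ioi (0 : ℝ), ∫⁻ x in Ioi (0 : ℝ), ENNReal.ofReal (x ^ a * l ^ c) *
      ENNReal.ofReal (Real.exp (-(x + l))) =
      ENNReal.ofReal (Real.Gamma (1 + a)) * ENNReal.ofReal (Real.Gamma (1 + c)) := by
    rw [← lintegral_rpow_mul_exp_neg hc, ← lintegral_const_mul _ (by fun_prop)]
    refine setLIntegral_congr_fun measurableSet_Ioi fun l (hl : 0 < l) => ?_
    rw [← lintegral_rpow_mul_exp_neg ha, ← lintegral_mul_const _ (by fun_prop)]
    refine setLIntegral_congr_fun measurableSet_Ioi fun x (hx : 0 < x) => ?_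
    rw [← ENNReal.ofReal_mul (by positivity), ← ENNReal.ofReal_mul (by positivity), neg_add,
      Real.exp_add]
    ring_nf
  rw [hleft, hright, ← ENNReal.ofReal_mul hΓa.le] at h
  rw [ENNReal.ofReal_div_of_pos hΓ, h]
  exact (ENNReal.mul_div_cancel_right (by simpa using hΓ) ENNReal.ofReal_ne_top).symm

/-- Liouville's extension of the Dirichlet integral in two variables. -/
lemma integral_rpow_mul_rpow_mul_comp_add {a c : ℝ} (ha : -1 < a) (hc : -1 < c) {φ : ℝ → ℝ}
    (hφ : Measurable φ) (hφ_nonneg : ∀ s, 0 < s → 0 ≤ φ s)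
    (hint : IntegrableOn (fun s => s ^ (a + c + 1) * φ s) (Ioi 0)) :
    ∫ l in Ioi (0 : ℝ), ∫ x in Ioi (0 : ℝ), x ^ a * l ^ c * φ (x + l) =
      Real.Gamma (1 + a) * Real.Gamma (1 + c) / Real.Gamma (a + c + 2) *
        ∫ s in Ioi (0 : ℝ), s ^ (a + c + 1) * φ s := by
  have hΓ : 0 < Real.Gamma (a + c + 2) := Real.Gamma_pos_of_pos (by linarith)
  have hΓa : 0 < Real.Gamma (1 + a) := Real.Gamma_pos_of_pos (by linarith)
  have hΓc : 0 < Real.Gamma (1 + c) := Real.Gamma_pos_of_pos (by linarith)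
  have h := lintegral_rpow_mul_rpow_mul_comp_add a c (φ := fun s => ENNReal.ofReal (φ s))
    (by fun_prop)
  have hright : ∫⁻ s in Ioi (0 : ℝ), ENNReal.ofReal (s ^ (a + c + 1)) * ENNReal.ofReal (φ s) =
      ENNReal.ofReal (∫ s in Ioi (0 : ℝ), s ^ (a + c + 1) * φ s) := by
    rw [ofReal_integral_eq_lintegral_ofReal hint]
    · refine setLIntegral_congr_fun measurableSet_Ioi fun s (hs : 0 < s) => ?_
      exact (ENNReal.ofReal_mul (by positivity)).symm
    · filter_upwards [ae_restrict_mem measurableSet_Ioi] with s (hs : 0 < s)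
      exact mul_nonneg (by positivity) (hφ_nonneg s hs)
  rw [hright, lintegral_rpow_mul_one_add_rpow ha hc, ← ENNReal.ofReal_mul (by positivity)] at h
  have hmeas : Measurable fun l : ℝ => ∫⁻ x in Ioi (0 : ℝ),
      ENNReal.ofReal (x ^ a * l ^ c) * ENNReal.ofReal (φ (x + l)) :=
    Measurable.lintegral_prod_right (by fun_prop)
  have hnonneg : 0 ≤ ∫ s in Ioi (0 : ℝ), s ^ (a + c + 1) * φ s :=
    setIntegral_nonneg measurableSet_Ioi fun s (hs : 0 < s) =>
      mul_nonneg (by positivity) (hφ_nonneg s hs)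
  calc
    _ = ∫ l in Ioi (0 : ℝ), (∫⁻ x in Ioi (0 : ℝ),
          ENNReal.ofReal (x ^ a * l ^ c) * ENNReal.ofReal (φ (x + l))).toReal := by
      refine setIntegral_congr_fun measurableSet_Ioi fun l (hl : 0 < l) => ?_
      rw [integral_eq_lintegral_of_nonneg_ae]
      · congr 1
        refine setLIntegral_congr_fun measurableSet_Ioi fun x (hx : 0 < x) => ?_
        exact ENNReal.ofReal_mul (by positivity)
      · filter_upwards [ae_restrict_mem measurableSet_Ioi] with x (hx : 0 < x)
        exact mul_nonneg (by positivity) (hφ_nonneg _ (by positivity))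
      · exact Measurable.aestronglyMeasurable (by fun_prop)
    _ = _ := by
      rw [integral_toReal hmeas.aemeasurable
        (ae_lt_top hmeas (h.trans_ne ENNReal.ofReal_ne_top)), h,
        ENNReal.toReal_ofReal (mul_nonneg (by positivity) hnonneg)]

theorem mellin_abs_BM_localtime_time_one (a c : ℝ) (ha : 0 < a) (hc : 0 < c) :
    (2 / Real.sqrt (2 * Real.pi)) *
        ∫ l in Ioi (0:ℝ), ∫ x in Ioi (0:ℝ),
          x ^ a * l ^ c * (x + l) * Real.exp (-(x + l) ^ 2 / 2)
      = Real.Gamma (1 + a) * Real.Gamma (1 + c) /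
          ((2:ℝ) ^ ((a + c) / 2) * Real.Gamma (1 + (a + c) / 2)) := by
  have hgauss : EqOn (fun s : ℝ => s ^ (a + c + 2) * Real.exp (-(1 / 2) * s ^ (2 : ℝ)))
      (fun s => s ^ (a + c + 1) * (s * Real.exp (-s ^ 2 / 2))) (Ioi 0) := by
    intro s (hs : 0 < s)
    dsimp only
    rw [show a + c + 2 = a + c + 1 + 1 by ring, Real.rpow_add_one hs.ne', Real.rpow_two, mul_assoc]
    ring_nf
  have hint : IntegrableOn (fun s : ℝ => s ^ (a + c + 1) * (s * Real.exp (-s ^ 2 / 2))) (Ioi 0) :=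
    (integrableOn_rpow_mul_exp_neg_mul_rpow (by linarith) two_pos (by norm_num)).congr_fun hgauss
      measurableSet_Ioi
  have hdirichlet := integral_rpow_mul_rpow_mul_comp_add (by linarith : -1 < a)
    (by linarith : -1 < c) (φ := fun s => s * Real.exp (-s ^ 2 / 2)) (by fun_prop)
    (fun s hs => by positivity) hint
  rw [← setIntegral_congr_fun measurableSet_Ioi hgauss,
    integral_rpow_mul_exp_neg_mul_rpow two_pos (by linarith) (by norm_num)] at hdirichlet
  simp_rw [mul_assoc] at hdirichlet ⊢
  rw [hdirichlet]
  have hdup := Real.Gamma_mul_Gamma_add_half (1 + (a + c) / 2)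
  rw [show 2 * (1 + (a + c) / 2) = a + c + 2 by ring,
    show 1 + (a + c) / 2 + 1 / 2 = (a + c + 2 + 1) / 2 by ring] at hdup
  have hΓ : 0 < Real.Gamma (a + c + 2) := Real.Gamma_pos_of_pos (by linarith)
  have hΓ' : 0 < Real.Gamma (1 + (a + c) / 2) := Real.Gamma_pos_of_pos (by linarith)
  have hpow : (1 / 2 : ℝ) ^ (-(a + c + 2 + 1) / 2) * (2 : ℝ) ^ ((a + c) / 2) *
      (2 : ℝ) ^ (1 - (a + c + 2)) = √2 := by
    rw [one_div, Real.inv_rpow two_pos.le, ← Real.rpow_neg two_pos.le, ← Real.rpow_add two_pos,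
      ← Real.rpow_add two_pos, Real.sqrt_eq_rpow]
    ring_nf
  have hpi : 0 < √Real.pi := Real.sqrt_pos.2 Real.pi_pos
  rw [Real.sqrt_mul two_pos.le]
  have hQ : 0 < (2 : ℝ) ^ ((a + c) / 2) := by positivity
  generalize (1 / 2 : ℝ) ^ (-(a + c + 2 + 1) / 2) = P at *
  generalize (2 : ℝ) ^ ((a + c) / 2) = Q at *
  generalize Real.Gamma (1 + (a + c) / 2) = G at *
  field_simp
  linear_combination P * Q * hdup + Real.Gamma (a + c + 2) * √Real.pi * hpow
end

section
/- Fix s > 0. Let μ be the measure on (0,∞) with density r ↦ √(2/(π s³))·r²·exp(−r²/(2s)) with respect to Lebesgue measure (the law of a three-dimensional Bessel process at time s started from 0), and let ν be the uniform probability measure on [0,1]. Then the pushforward of the product measure μ ⊗ ν under the map (r,u) ↦ (r·(1−u), r·u) is the measure on (0,∞)×(0,∞) with density (x,l) ↦ (2/√(2π s³))·(x+l)·exp(−(x+l)²/(2s)) with respect to two-dimensional Lebesgue measure. -/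
open MeasureTheory Set

/-- The total derivative of `(r, u) ↦ (r * (1 - u), r * u)`. -/
noncomputable def fderivBarycentric (p : ℝ × ℝ) : ℝ × ℝ →L[ℝ] ℝ × ℝ :=
  (Matrix.toLin (.finTwoProd ℝ) (.finTwoProd ℝ)
    !![1 - p.2, -p.1; p.2, p.1]).toContinuousLinearMap

theorem hasFDerivAt_barycentric (p : ℝ × ℝ) :
    HasFDerivAt (fun p : ℝ × ℝ => (p.1 * (1 - p.2), p.1 * p.2)) (fderivBarycentric p) p := by
  unfold fderivBarycentric
  rw [Matrix.toLin_finTwoProd_toContinuousLinearMap]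
  have hfst : HasFDerivAt (fun p : ℝ × ℝ => p.1) (.fst ℝ ℝ ℝ) p := hasFDerivAt_fst
  have hsnd : HasFDerivAt (fun p : ℝ × ℝ => p.2) (.snd ℝ ℝ ℝ) p := hasFDerivAt_snd
  convert! (hfst.mul (hsnd.const_sub 1)).prodMk (hfst.mul hsnd) using 2 <;>
  simp [add_comm, neg_smul _ (ContinuousLinearMap.snd ℝ ℝ ℝ)]

theorem det_fderivBarycentric (p : ℝ × ℝ) : (fderivBarycentric p).det = p.1 := by
  simp only [fderivBarycentric, LinearMap.det_toContinuousLinearMap, LinearMap.det_toLin,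
    Matrix.det_fin_two_of]
  ring

theorem injOn_barycentric :
    InjOn (fun p : ℝ × ℝ => (p.1 * (1 - p.2), p.1 * p.2)) (Ioi 0 ×ˢ Ioo 0 1) := by
  rintro ⟨r, u⟩ ⟨hr, -⟩ ⟨r', u'⟩ - h
  simp only [Prod.mk.injEq] at h
  obtain rfl : r = r' := by linarith [h.1, h.2]
  exact Prod.ext rfl (mul_left_cancel₀ (ne_of_gt hr) h.2)

theorem image_barycentric_inter_preimage (A : Set (ℝ × ℝ)) :
    (fun p : ℝ × ℝ => (p.1 * (1 - p.2), p.1 * p.2)) ''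
      (Ioi 0 ×ˢ Ioo 0 1 ∩ (fun p : ℝ × ℝ => (p.1 * (1 - p.2), p.1 * p.2)) ⁻¹' A) =
      A ∩ Ioi 0 ×ˢ Ioi 0 := by
  rw [image_inter_preimage, inter_comm]
  congr 1
  ext ⟨x, l⟩
  constructor
  · rintro ⟨⟨r, u⟩, ⟨hr, hu⟩, h⟩
    obtain ⟨rfl, rfl⟩ := Prod.mk.inj h
    exact ⟨mul_pos hr (sub_pos.2 hu.2), mul_pos hr hu.1⟩
  · rintro ⟨hx : 0 < x, hl : 0 < l⟩
    have hxl : 0 < x + l := add_pos hx hl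
    refine ⟨(x + l, l / (x + l)), ⟨hxl, div_pos hl hxl, (div_lt_one hxl).2 (by linarith)⟩, ?_⟩
    ext <;> simp only <;> field_simp
    ring

/-- If `R` has density `r * g r` on `(0, ∞)` and `U` is an independent uniform variable, then
`R * (1 - U, U)` has density `g (x + l)` on the open quadrant. -/
theorem map_barycentric_prod_uniform {g : ℝ → ENNReal} (hg : Measurable g) :
    Measure.map (fun p : ℝ × ℝ => (p.1 * (1 - p.2), p.1 * p.2))
        (((volume.restrict (Ioi (0:ℝ))).withDensity (fun r => ENNReal.ofReal r * g r)).prod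
          (volume.restrict (Icc (0:ℝ) 1)))
      = (volume.restrict (Ioi (0:ℝ) ×ˢ Ioi (0:ℝ))).withDensity (fun q => g (q.1 + q.2)) := by
  have hf : Measurable (fun p : ℝ × ℝ => (p.1 * (1 - p.2), p.1 * p.2)) := by fun_prop
  rw [prod_withDensity_left (by fun_prop), ← restrict_Ioo_eq_restrict_Icc,
    Measure.prod_restrict, ← Measure.volume_eq_prod]
  ext A hA
  have hT : MeasurableSet (Ioi (0:ℝ) ×ˢ Ioo (0:ℝ) 1 ∩
      (fun p : ℝ × ℝ => (p.1 * (1 - p.2), p.1 * p.2)) ⁻¹' A) :=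
    (measurableSet_Ioi.prod measurableSet_Ioo).inter (hf hA)
  rw [Measure.map_apply hf hA, withDensity_apply _ (hf hA), withDensity_apply _ hA,
    Measure.restrict_restrict (hf hA), Measure.restrict_restrict hA,
    ← image_barycentric_inter_preimage, inter_comm,
    lintegral_image_eq_lintegral_abs_det_fderiv_mul volume hT
      (fun p _ => (hasFDerivAt_barycentric p).hasFDerivWithinAt)
      (injOn_barycentric.mono inter_subset_left)]
  refine setLIntegral_congr_fun hT fun p hp => ?_
  have hp : 0 < p.1 := hp.1.1
  simp only [det_fderivBarycentric, abs_of_pos hp]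
  congr 2
  ring

theorem bessel_uniform_factorization (s : ℝ) (hs : 0 < s) :
    Measure.map (fun p : ℝ × ℝ => (p.1 * (1 - p.2), p.1 * p.2))
        (((volume.restrict (Ioi (0:ℝ))).withDensity
            (fun r => ENNReal.ofReal (Real.sqrt (2 / (Real.pi * s ^ 3)) * r ^ 2 *
              Real.exp (-r ^ 2 / (2 * s))))).prod
          (volume.restrict (Icc (0:ℝ) 1)))
      = (volume.restrict (Ioi (0:ℝ) ×ˢ Ioi (0:ℝ))).withDensity
          (fun q => ENNReal.ofReal ((2 / Real.sqrt (2 * Real.pi * s ^ 3)) * (q.1 + q.2) *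
            Real.exp (-(q.1 + q.2) ^ 2 / (2 * s)))) := by
  have hc : Real.sqrt (2 / (Real.pi * s ^ 3)) = 2 / Real.sqrt (2 * Real.pi * s ^ 3) := by
    have hπ := Real.pi_pos
    rw [show 2 / (Real.pi * s ^ 3) = 2 ^ 2 / (2 * Real.pi * s ^ 3) by field_simp,
      Real.sqrt_div (by positivity), Real.sqrt_sq (by norm_num)]
  rw [← map_barycentric_prod_uniform (g := fun r => ENNReal.ofReal
    (2 / Real.sqrt (2 * Real.pi * s ^ 3) * r * Real.exp (-r ^ 2 / (2 * s)))) (by fun_prop)]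
  congr 2
  refine withDensity_congr_ae ((ae_restrict_iff' measurableSet_Ioi).2 (.of_forall fun r hr => ?_))
  simp only
  rw [← ENNReal.ofReal_mul (le_of_lt hr), hc]
  congr 1
  ring
end

section
/- For all a ≥ 0, c ≥ 0 and 0 < l ≤ 1, one has (1/(2^{(a+c)/2}·Γ(1+(a+c)/2)))·∫₀^∞ μ^{1+a+c} · [ e^{−μ} · ∫₀^∞ ∫₀^l x^a · e^{μ(m−x)} · 2·( ∫₀^∞ ((m+x)/√(2π s³))·exp(−(m+x)²/(2s) − μ²s/2) ds ) dm dx ] dμ = l·Γ(1+a)·Γ(1+c) / (2^{(a+c)/2}·Γ(1+(a+c)/2)·2^a), where Γ is the classical gamma function. -/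
open MeasureTheory Set

open Filter Topology in
/-- The fundamental theorem of calculus on `(a, ∞)` for a nonnegative derivative, with a one-sided
limit at `a`. -/
lemma integral_Ioi_of_hasDerivAt_of_nonneg_of_tendsto_nhdsGT {g g' : ℝ → ℝ} {a k l : ℝ}
    (hderiv : ∀ x ∈ Ioi a, HasDerivAt g (g' x) x) (hnonneg : ∀ x ∈ Ioi a, 0 ≤ g' x)
    (ha : Tendsto g (𝓝[>] a) (𝓝 k)) (hl : Tendsto g atTop (𝓝 l)) :
    ∫ x in Ioi a, g' x = l - k := by
  have heq : ∀ x ∈ Ioi a, Function.update g a k x = g x := fun x hx =>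
    Function.update_of_ne (ne_of_gt hx) _ _
  rw [integral_Ioi_of_hasDerivAt_of_nonneg (g := Function.update g a k) (l := l) ?_ ?_ hnonneg ?_,
    Function.update_self]
  · rw [continuousWithinAt_update_same, Ici_sdiff_left]
    exact ha
  · intro x hx
    exact (hderiv x hx).congr_of_eventuallyEq (eventually_of_mem (Ioi_mem_nhds hx) heq)
  · exact hl.congr' (eventually_of_mem (Ioi_mem_atTop a) fun x hx => (heq x hx).symm)

/-- The primitive of `exp (-t ^ 2 / 2)` that vanishes at the origin. -/
noncomputable def gaussianPrimitive (y : ℝ) : ℝ := ∫ t in (0:ℝ)..y, Real.exp (-(1 / 2) * t ^ 2)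

lemma hasDerivAt_gaussianPrimitive (y : ℝ) :
    HasDerivAt gaussianPrimitive (Real.exp (-(1 / 2) * y ^ 2)) y := by
  have h : Continuous fun t : ℝ => Real.exp (-(1 / 2) * t ^ 2) := by fun_prop
  exact (h.integral_hasStrictDerivAt 0 y).hasDerivAt

lemma gaussianPrimitive_neg (y : ℝ) : gaussianPrimitive (-y) = -gaussianPrimitive y := by
  have h := intervalIntegral.integral_comp_neg (a := 0) (b := y)
    fun t : ℝ => Real.exp (-(1 / 2) * t ^ 2)
  simp only [neg_sq, neg_zero] at h
  rw [gaussianPrimitive, gaussianPrimitive, h, intervalIntegral.integral_symm]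

open Filter Topology in
lemma tendsto_gaussianPrimitive_atTop :
    Tendsto gaussianPrimitive atTop (𝓝 (√(2 * Real.pi) / 2)) := by
  have h := intervalIntegral_tendsto_integral_Ioi (0:ℝ)
    (integrable_exp_neg_mul_sq (b := 1 / 2) (by norm_num)).integrableOn tendsto_id
  rw [integral_gaussian_Ioi, show Real.pi / (1 / 2) = 2 * Real.pi by ring] at h
  exact h

open Filter Topology in
lemma tendsto_gaussianPrimitive_atBot :
    Tendsto gaussianPrimitive atBot (𝓝 (-(√(2 * Real.pi) / 2))) := by
  refine (tendsto_gaussianPrimitive_atTop.comp tendsto_neg_atBot_atTop).neg.congr fun y => ?_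
  simp [gaussianPrimitive_neg]

open Filter Topology in
/-- The Laplace transform of the hitting time of level `b` by a standard Brownian motion. -/
lemma integral_hittingTime_density_mul_exp {b μ : ℝ} (hb : 0 < b) (hμ : 0 < μ) :
    ∫ s in Ioi (0:ℝ), (b / √(2 * Real.pi * s ^ 3)) *
      Real.exp (-b ^ 2 / (2 * s) - μ ^ 2 * s / 2) = Real.exp (-(μ * b)) := by
  have hpi : 0 < √(2 * Real.pi) := by positivity
  have hsqrt_top : Tendsto (fun s : ℝ => √s) atTop atTop := Real.tendsto_sqrt_atTop
  have hsqrt_zero : Tendsto (fun s : ℝ => √s) (𝓝[>] 0) (𝓝[>] 0) := by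
    refine tendsto_nhdsWithin_iff.2 ⟨?_, ?_⟩
    · simpa using (Real.continuous_sqrt.tendsto 0).mono_left nhdsWithin_le_nhds
    · filter_upwards [self_mem_nhdsWithin] with s hs using Real.sqrt_pos.2 hs
  have hmul_top : Tendsto (fun s : ℝ => μ * √s) atTop atTop := hsqrt_top.const_mul_atTop hμ
  have hdiv_top : Tendsto (fun s : ℝ => b / √s) atTop (𝓝 0) := hsqrt_top.const_div_atTop b
  have hmul_zero : Tendsto (fun s : ℝ => μ * √s) (𝓝[>] 0) (𝓝 (μ * 0)) :=
    (hsqrt_zero.mono_right nhdsWithin_le_nhds).const_mul μ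
  have hdiv_zero : Tendsto (fun s : ℝ => b / √s) (𝓝[>] 0) atTop := by
    simp only [div_eq_mul_inv]
    exact (tendsto_inv_nhdsGT_zero.comp hsqrt_zero).const_mul_atTop hb
  let G : ℝ → ℝ := fun s => 1 / √(2 * Real.pi) *
    (Real.exp (-(μ * b)) * gaussianPrimitive (μ * √s - b / √s) -
      Real.exp (μ * b) * gaussianPrimitive (μ * √s + b / √s))
  rw [integral_Ioi_of_hasDerivAt_of_nonneg_of_tendsto_nhdsGT (g := G)
    (k := 1 / √(2 * Real.pi) * (Real.exp (-(μ * b)) * -(√(2 * Real.pi) / 2) -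
      Real.exp (μ * b) * (√(2 * Real.pi) / 2)))
    (l := 1 / √(2 * Real.pi) * (Real.exp (-(μ * b)) * (√(2 * Real.pi) / 2) -
      Real.exp (μ * b) * (√(2 * Real.pi) / 2)))]
  · field_simp
    ring
  · intro s hs
    have hs : 0 < s := hs
    obtain ⟨r, hr, rfl⟩ : ∃ r : ℝ, 0 < r ∧ s = r ^ 2 :=
      ⟨√s, Real.sqrt_pos.2 hs, (Real.sq_sqrt hs.le).symm⟩
    have hr' : √(r ^ 2) = r := Real.sqrt_sq hr.le
    have hd : HasDerivAt (fun s : ℝ => √s) (1 / (2 * r)) (r ^ 2) := by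
      simpa [hr'] using Real.hasDerivAt_sqrt hs.ne'
    have hm := hd.const_mul μ
    have hq := (hasDerivAt_const (r ^ 2) b).div hd (by rw [hr']; exact hr.ne')
    have h1 := ((hasDerivAt_gaussianPrimitive _).comp _ (hm.sub hq)).const_mul (Real.exp (-(μ * b)))
    have h2 := ((hasDerivAt_gaussianPrimitive _).comp _ (hm.add hq)).const_mul (Real.exp (μ * b))
    refine ((h1.sub h2).const_mul (1 / √(2 * Real.pi))).congr_deriv ?_
    simp only [Pi.sub_apply, Pi.add_apply, Pi.div_apply, hr']
    rw [← mul_assoc (Real.exp _), ← mul_assoc (Real.exp _), ← Real.exp_add, ← Real.exp_add,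
      show -(μ * b) + -(1 / 2) * (μ * r - b / r) ^ 2 =
        -b ^ 2 / (2 * r ^ 2) - μ ^ 2 * r ^ 2 / 2 by field_simp; ring,
      show μ * b + -(1 / 2) * (μ * r + b / r) ^ 2 =
        -b ^ 2 / (2 * r ^ 2) - μ ^ 2 * r ^ 2 / 2 by field_simp; ring,
      Real.sqrt_mul (x := 2 * Real.pi) (by positivity), show (r ^ 2) ^ 3 = (r ^ 3) ^ 2 by ring,
      Real.sqrt_sq (by positivity)]
    field_simp
    ring
  · intro s _
    positivity
  · refine (((tendsto_gaussianPrimitive_atBot.comp ?_).const_mul _).sub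
      ((tendsto_gaussianPrimitive_atTop.comp ?_).const_mul _)).const_mul _
    · simpa [sub_eq_add_neg] using hmul_zero.add_atBot (tendsto_neg_atTop_atBot.comp hdiv_zero)
    · exact hmul_zero.add_atTop hdiv_zero
  · refine (((tendsto_gaussianPrimitive_atTop.comp ?_).const_mul _).sub
      ((tendsto_gaussianPrimitive_atTop.comp ?_).const_mul _)).const_mul _
    · simpa [sub_eq_add_neg] using hmul_top.atTop_add hdiv_top.neg
    · exact hmul_top.atTop_add hdiv_top

theorem mellin_type_transform_identity (a c l : ℝ) (ha : 0 ≤ a) (hc : 0 ≤ c)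
    (hl0 : 0 < l) (hl1 : l ≤ 1) :
    (1 / ((2:ℝ) ^ ((a + c) / 2) * Real.Gamma (1 + (a + c) / 2))) *
        ∫ μ in Ioi (0:ℝ), μ ^ (1 + a + c) *
          (Real.exp (-μ) *
            ∫ x in Ioi (0:ℝ), ∫ m in (0:ℝ)..l,
              x ^ a * Real.exp (μ * (m - x)) *
                (2 * ∫ s in Ioi (0:ℝ),
                  ((m + x) / Real.sqrt (2 * Real.pi * s ^ 3)) *
                    Real.exp (-(m + x) ^ 2 / (2 * s) - μ ^ 2 * s / 2)))
      = l * Real.Gamma (1 + a) * Real.Gamma (1 + c) /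
          ((2:ℝ) ^ ((a + c) / 2) * Real.Gamma (1 + (a + c) / 2) * (2:ℝ) ^ a) := by
  have inner : ∀ μ ∈ Ioi (0:ℝ), ∀ x ∈ Ioi (0:ℝ), (∫ m in (0:ℝ)..l,
      x ^ a * Real.exp (μ * (m - x)) * (2 * ∫ s in Ioi (0:ℝ),
        ((m + x) / Real.sqrt (2 * Real.pi * s ^ 3)) *
          Real.exp (-(m + x) ^ 2 / (2 * s) - μ ^ 2 * s / 2)))
      = 2 * l * (x ^ ((1 + a) - 1) * Real.exp (-(2 * μ * x))) := by
    intro μ hμ x hx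
    have hconst : ∀ m ∈ uIcc 0 l, x ^ a * Real.exp (μ * (m - x)) * (2 * ∫ s in Ioi (0:ℝ),
        ((m + x) / Real.sqrt (2 * Real.pi * s ^ 3)) *
          Real.exp (-(m + x) ^ 2 / (2 * s) - μ ^ 2 * s / 2))
        = 2 * (x ^ a * Real.exp (-(2 * μ * x))) := by
      intro m hm
      rw [uIcc_of_le hl0.le] at hm
      rw [integral_hittingTime_density_mul_exp (add_pos_of_nonneg_of_pos hm.1 hx) hμ,
        show -(2 * μ * x) = μ * (m - x) + -(μ * (m + x)) by ring, Real.exp_add]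
      ring
    rw [intervalIntegral.integral_congr hconst, intervalIntegral.integral_const, smul_eq_mul,
      add_sub_cancel_left]
    ring
  have outer : ∀ μ ∈ Ioi (0:ℝ), μ ^ (1 + a + c) * (Real.exp (-μ) *
      ∫ x in Ioi (0:ℝ), ∫ m in (0:ℝ)..l, x ^ a * Real.exp (μ * (m - x)) *
        (2 * ∫ s in Ioi (0:ℝ), ((m + x) / Real.sqrt (2 * Real.pi * s ^ 3)) *
          Real.exp (-(m + x) ^ 2 / (2 * s) - μ ^ 2 * s / 2)))
      = l * Real.Gamma (1 + a) / 2 ^ a * (Real.exp (-μ) * μ ^ ((1 + c) - 1)) := by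
    intro μ hμ
    have hμ0 : 0 < μ := hμ
    rw [setIntegral_congr_fun measurableSet_Ioi (inner μ hμ), integral_const_mul,
      Real.integral_rpow_mul_exp_neg_mul_Ioi (by positivity) (by positivity),
      Real.rpow_add hμ0, one_div, Real.inv_rpow (by positivity),
      Real.mul_rpow zero_le_two hμ0.le, Real.rpow_add zero_lt_two, Real.rpow_one,
      add_sub_cancel_left]
    field_simp
  rw [setIntegral_congr_fun measurableSet_Ioi outer, integral_const_mul,
    ← Real.Gamma_eq_integral (by positivity)]
  have hΓ := Real.Gamma_pos_of_pos (show 0 < 1 + (a + c) / 2 by positivity)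
  field_simp
end

section
/- Let Λ and U be independent uniform random variables on [0,1] (i.e., take the uniform probability measure on [0,1]²). Then the pushforward of this measure under the map (λ,u) ↦ λ·u − (1−u)/2 has density u(x) with respect to Lebesgue measure on ℝ, where u(x) = log 3 for −1/2 ≤ x ≤ 0, u(x) = log(3/(1+2x)) for 0 ≤ x ≤ 1, and u(x) = 0 for x < −1/2 or x > 1. -/
open MeasureTheory Set

lemma lintegral_Icc_inv_add_half {a : ℝ} (ha : 0 ≤ a) (ha1 : a ≤ 1) :
    ∫⁻ l in Icc a 1, ENNReal.ofReal (l + 1 / 2)⁻¹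
      = ENNReal.ofReal (Real.log (3 / (1 + 2 * a))) := by
  have hcont : ContinuousOn (fun l : ℝ => (l + 1 / 2)⁻¹) (Icc a 1) := by
    refine ContinuousOn.inv₀ (by fun_prop) fun l hl => ?_
    have := ha.trans hl.1
    positivity
  rw [← ofReal_integral_eq_lintegral_ofReal (hcont.integrableOn_compact isCompact_Icc),
    integral_Icc_eq_integral_Ioc, ← intervalIntegral.integral_of_le ha1,
    intervalIntegral.integral_eq_sub_of_hasDerivAt (f := fun l => Real.log (l + 1 / 2))]
  · rw [← Real.log_div (by norm_num) (by positivity)]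
    congr 2
    field_simp
    ring
  · intro l hl
    rw [uIcc_of_le ha1] at hl
    have : l + 1 / 2 ≠ 0 := by linarith [hl.1]
    simpa using ((hasDerivAt_id l).add_const (1 / 2)).log this
  · exact ContinuousOn.intervalIntegrable (by rwa [uIcc_of_le ha1])
  · filter_upwards [ae_restrict_mem measurableSet_Icc] with l hl
    have := ha.trans hl.1
    simp only [Pi.zero_apply]
    positivity

lemma lintegral_Icc_comp_affine {l : ℝ} (hl : 0 ≤ l) (g : ℝ → ENNReal) :
    ∫⁻ t in Icc (0 : ℝ) 1, g (l * t - (1 - t) / 2)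
      = ∫⁻ x in Icc (-(1 / 2)) l, ENNReal.ofReal (l + 1 / 2)⁻¹ * g x := by
  have hc : 0 < l + 1 / 2 := by positivity
  have himage : (fun t : ℝ => l * t - (1 - t) / 2) '' Icc 0 1 = Icc (-(1 / 2)) l := by
    have : (fun t : ℝ => l * t - (1 - t) / 2) = fun t => (l + 1 / 2) * t + -(1 / 2) := by
      ext t; ring
    rw [this, image_affine_Icc' hc]
    congr 1 <;> ring
  rw [← himage, lintegral_image_eq_lintegral_abs_deriv_mul measurableSet_Icc
    (f' := fun _ => l + 1 / 2)]
  · refine lintegral_congr fun t => ?_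
    rw [← mul_assoc, ← ENNReal.ofReal_mul (abs_nonneg _), abs_of_pos hc,
      mul_inv_cancel₀ hc.ne', ENNReal.ofReal_one, one_mul]
  · intro t _
    refine HasDerivAt.hasDerivWithinAt ?_
    have := ((hasDerivAt_id' t).const_mul l).sub (((hasDerivAt_id' t).const_sub 1).div_const 2)
    exact this.congr_deriv (by ring)
  · intro s _ t _ h
    have : (l + 1 / 2) * s = (l + 1 / 2) * t := by
      simp only at h
      linarith
    exact mul_left_cancel₀ hc.ne' this

theorem density_of_A (u : ℝ → ℝ)
    (h1 : ∀ x : ℝ, -(1/2) ≤ x → x ≤ 0 → u x = Real.log 3)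
    (h2 : ∀ x : ℝ, 0 ≤ x → x ≤ 1 → u x = Real.log (3 / (1 + 2 * x)))
    (h3 : ∀ x : ℝ, x < -(1/2) ∨ 1 < x → u x = 0) :
    Measure.map (fun p : ℝ × ℝ => p.1 * p.2 - (1 - p.2) / 2)
        (volume.restrict (Icc (0:ℝ) 1 ×ˢ Icc (0:ℝ) 1))
      = volume.withDensity (fun x => ENNReal.ofReal (u x)) := by
  have hf : Measurable (fun p : ℝ × ℝ => p.1 * p.2 - (1 - p.2) / 2) := by fun_prop
  have hdensity : ∀ x : ℝ, ∫⁻ l in Icc (0 : ℝ) 1,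
      (Icc (-(1 / 2)) l).indicator (fun _ => ENNReal.ofReal (l + 1 / 2)⁻¹) x
        = ENNReal.ofReal (u x) := by
    intro x
    by_cases hx : -(1 / 2) ≤ x ∧ x ≤ 1
    · have hux : u x = Real.log (3 / (1 + 2 * max 0 x)) := by
        rcases le_total x 0 with h | h
        · simp [h1 x hx.1 h, max_eq_left h]
        · rw [h2 x h hx.2, max_eq_right h]
      rw [hux, ← lintegral_Icc_inv_add_half (le_max_left 0 x) (max_le zero_le_one hx.2),
        ← lintegral_indicator measurableSet_Icc, ← lintegral_indicator measurableSet_Icc]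
      refine lintegral_congr fun l => ?_
      simp only [indicator, mem_Icc, max_le_iff]
      split_ifs <;> first | rfl | (exfalso; tauto)
    · rw [h3 x (by by_contra! h; exact hx h), ENNReal.ofReal_zero]
      refine setLIntegral_eq_zero measurableSet_Icc fun l hl => ?_
      exact indicator_of_notMem (fun h => hx ⟨h.1, h.2.trans hl.2⟩) _
  ext s hs
  have hmeas : Measurable (fun p : ℝ × ℝ => (Icc (-(1 / 2)) p.1).indicator
      (fun _ => ENNReal.ofReal (p.1 + 1 / 2)⁻¹) p.2) := by
    have hset : MeasurableSet {p : ℝ × ℝ | -(1 / 2) ≤ p.2 ∧ p.2 ≤ p.1} :=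
      (measurableSet_le measurable_const measurable_snd).inter
        (measurableSet_le measurable_snd measurable_fst)
    exact Measurable.indicator
      (f := fun p : ℝ × ℝ => ENNReal.ofReal (p.1 + 1 / 2)⁻¹) (by fun_prop) hset
  have hind : Measurable (s.indicator (1 : ℝ → ENNReal)) := measurable_one.indicator hs
  calc Measure.map (fun p : ℝ × ℝ => p.1 * p.2 - (1 - p.2) / 2)
        (volume.restrict (Icc (0:ℝ) 1 ×ˢ Icc (0:ℝ) 1)) s
      = ∫⁻ l in Icc (0 : ℝ) 1, ∫⁻ t in Icc (0 : ℝ) 1,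
          s.indicator 1 (l * t - (1 - t) / 2) := by
        rw [← lintegral_indicator_one hs, lintegral_map hind hf, Measure.volume_eq_prod,
          ← Measure.prod_restrict]
        exact lintegral_prod _ (hind.comp hf).aemeasurable
    _ = ∫⁻ l in Icc (0 : ℝ) 1, ∫⁻ x in s,
          (Icc (-(1 / 2)) l).indicator (fun _ => ENNReal.ofReal (l + 1 / 2)⁻¹) x := by
        refine setLIntegral_congr_fun measurableSet_Icc fun l hl => ?_
        rw [lintegral_Icc_comp_affine hl.1, ← lintegral_indicator measurableSet_Icc,
          ← lintegral_indicator hs]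
        refine lintegral_congr fun x => ?_
        by_cases hxs : x ∈ s <;> by_cases hxl : x ∈ Icc (-(1 / 2)) l <;>
          simp only [indicator, hxs, hxl, if_true, if_false, Pi.one_apply, mul_one, mul_zero]
    _ = ∫⁻ x in s, ENNReal.ofReal (u x) := by
        rw [lintegral_lintegral_swap hmeas.aemeasurable]
        exact lintegral_congr hdensity
    _ = volume.withDensity (fun x => ENNReal.ofReal (u x)) s := (withDensity_apply _ hs).symm
end

section
/- The two-dimensional Lebesgue measure of the set {(λ,u) ∈ [0,1]×[0,1] : λ·u > (1−u)/2} equals 1 − (log 3)/2. -/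
open MeasureTheory Set

lemma hasDerivAt_sub_half_log {x : ℝ} (hx : 0 < 1 + 2 * x) :
    HasDerivAt (fun y : ℝ => y - Real.log (1 + 2 * y) / 2) (1 - 1 / (1 + 2 * x)) x := by
  have h : HasDerivAt (fun y : ℝ => 1 + 2 * y) 2 x := by
    simpa using ((hasDerivAt_id x).const_mul 2).const_add 1
  refine ((hasDerivAt_id' x).sub ((h.log hx.ne').div_const 2)).congr_deriv ?_
  field_simp

lemma continuousOn_one_sub_one_div :
    ContinuousOn (fun x : ℝ => 1 - 1 / (1 + 2 * x)) (Icc 0 1) := by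
  refine continuousOn_const.sub (continuousOn_const.div (by fun_prop) fun x hx => ?_)
  linarith [hx.1]

lemma setIntegral_one_sub_one_div :
    ∫ x in Icc (0 : ℝ) 1, (1 - 1 / (1 + 2 * x)) = 1 - Real.log 3 / 2 := by
  rw [integral_Icc_eq_integral_Ioc, ← intervalIntegral.integral_of_le zero_le_one,
    intervalIntegral.integral_eq_sub_of_hasDerivAt
      (f := fun y : ℝ => y - Real.log (1 + 2 * y) / 2)]
  · norm_num
  · intro x hx
    rw [uIcc_of_le zero_le_one] at hx
    exact hasDerivAt_sub_half_log (by linarith [hx.1])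
  · exact ContinuousOn.intervalIntegrable_of_Icc zero_le_one continuousOn_one_sub_one_div

lemma preimage_mk_eq_Ioc {x : ℝ} (hx : x ∈ Icc (0 : ℝ) 1) :
    Prod.mk x ⁻¹' {p : ℝ × ℝ | p ∈ Icc (0:ℝ) 1 ×ˢ Icc (0:ℝ) 1 ∧ p.1 * p.2 > (1 - p.2) / 2}
      = Ioc (1 / (1 + 2 * x)) 1 := by
  have h : 0 < 1 + 2 * x := by linarith [hx.1]
  ext u
  simp only [mem_preimage, mem_ofPred_eq, mem_prod, mem_Ioc, div_lt_iff₀ h]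
  constructor
  · rintro ⟨⟨-, hu⟩, hlt⟩
    exact ⟨by linarith, hu.2⟩
  · rintro ⟨hlt, hu⟩
    exact ⟨⟨hx, by nlinarith, hu⟩, by linarith⟩

theorem prob_A_pos :
    volume {p : ℝ × ℝ | p ∈ Icc (0:ℝ) 1 ×ˢ Icc (0:ℝ) 1 ∧ p.1 * p.2 > (1 - p.2) / 2}
      = ENNReal.ofReal (1 - Real.log 3 / 2) := by
  have hmeas : MeasurableSet
      {p : ℝ × ℝ | p ∈ Icc (0:ℝ) 1 ×ˢ Icc (0:ℝ) 1 ∧ p.1 * p.2 > (1 - p.2) / 2} :=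
    (measurableSet_Icc.prod measurableSet_Icc).inter
      (measurableSet_lt (f := fun p : ℝ × ℝ => (1 - p.2) / 2) (g := fun p => p.1 * p.2)
        (by fun_prop) (by fun_prop))
  rw [Measure.volume_eq_prod, Measure.prod_apply hmeas, ← setIntegral_one_sub_one_div,
    ofReal_integral_eq_lintegral_ofReal
      (continuousOn_one_sub_one_div.integrableOn_compact isCompact_Icc),
    ← lintegral_indicator measurableSet_Icc]
  · refine lintegral_congr fun x => ?_
    by_cases hx : x ∈ Icc (0 : ℝ) 1
    · rw [indicator_of_mem hx, preimage_mk_eq_Ioc hx, Real.volume_Ioc]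
    · rw [indicator_of_notMem hx]
      convert measure_empty (μ := (volume : Measure ℝ))
      exact eq_empty_of_forall_notMem fun u hu => hx hu.1.1
  · filter_upwards [ae_restrict_mem measurableSet_Icc] with x hx
    have h : 1 / (1 + 2 * x) ≤ 1 := div_le_one_of_le₀ (by linarith [hx.1]) (by linarith [hx.1])
    simpa using h
end

section
/- Let V be uniform on [0,1] and let Z be an independent random variable with density z ↦ 2z / ((1 − (log 3)/2)·(1+2z)) on (0,1). Then the product V·Z has density x ↦ (1/(1 − (log 3)/2))·log(3/(1+2x)) on (0,1). Equivalently: the pushforward under (v,z) ↦ v·z of the product of the uniform measure on [0,1] and the measure on (0,1) with density z ↦ 2z/((1 − (log 3)/2)(1+2z)) is the measure with density x ↦ (1/(1 − (log 3)/2))·log(3/(1+2x))·1_{(0,1)}(x). -/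
open MeasureTheory Set

lemma lintegral_Icc_comp_mul_right {z : ℝ} (hz : 0 < z) {f : ℝ → ENNReal} (hf : Measurable f) :
    ∫⁻ v in Icc (0 : ℝ) 1, f (v * z) = ENNReal.ofReal z⁻¹ * ∫⁻ x in Ioo 0 z, f x := by
  have hpre : ∀ v, (Ioo (0 : ℝ) 1).indicator (fun v => f (v * z)) v
      = (Ioo 0 z).indicator f (v * z) := by
    intro v
    have : v ∈ Ioo (0 : ℝ) 1 ↔ v * z ∈ Ioo 0 z := by
      simp only [mem_Ioo, mul_pos_iff_of_pos_right hz, mul_lt_iff_lt_one_left hz]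
    by_cases h : v ∈ Ioo (0 : ℝ) 1
    · rw [indicator_of_mem h, indicator_of_mem (this.1 h)]
    · rw [indicator_of_notMem h, indicator_of_notMem (this.not.1 h)]
  rw [← Measure.restrict_congr_set Ioo_ae_eq_Icc, ← lintegral_indicator measurableSet_Ioo,
    lintegral_congr hpre,
    ← lintegral_map (hf.indicator measurableSet_Ioo) (measurable_mul_const z),
    Real.map_volume_mul_right hz.ne', lintegral_smul_measure,
    lintegral_indicator measurableSet_Ioo, abs_of_pos (inv_pos.2 hz), smul_eq_mul]

/-- The law of a product of a uniform variable on `[0, 1]` and an independent variable with density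
`g` on `(0, 1)`. -/
lemma map_mul_uniform_prod_withDensity {g : ℝ → ENNReal} (hg : Measurable g)
    [SFinite ((volume.restrict (Ioo (0 : ℝ) 1)).withDensity g)] :
    Measure.map (fun p : ℝ × ℝ => p.1 * p.2)
        ((volume.restrict (Icc (0 : ℝ) 1)).prod
          ((volume.restrict (Ioo (0 : ℝ) 1)).withDensity g))
      = volume.withDensity
          ((Ioo (0 : ℝ) 1).indicator fun x => ∫⁻ z in Ioo x 1, g z * ENNReal.ofReal z⁻¹) := by
  have hT : MeasurableSet {p : ℝ × ℝ | 0 < p.1 ∧ p.1 < p.2 ∧ p.2 < 1} :=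
    (measurableSet_lt measurable_const measurable_fst).inter
      ((measurableSet_lt measurable_fst measurable_snd).inter
        (measurableSet_lt measurable_snd measurable_const))
  have hG : Measurable fun z : ℝ => g z * ENNReal.ofReal z⁻¹ := by fun_prop
  have hdens : ((Ioo (0 : ℝ) 1).indicator fun x => ∫⁻ z in Ioo x 1, g z * ENNReal.ofReal z⁻¹)
      = fun x => ∫⁻ z, {p : ℝ × ℝ | 0 < p.1 ∧ p.1 < p.2 ∧ p.2 < 1}.indicator
          (fun p => g p.2 * ENNReal.ofReal p.2⁻¹) (x, z) := by
    ext x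
    by_cases hx : x ∈ Ioo (0 : ℝ) 1
    · rw [indicator_of_mem hx, ← lintegral_indicator measurableSet_Ioo]
      refine lintegral_congr fun z => ?_
      simp [indicator, hx.1]
    · rw [indicator_of_notMem hx]
      symm
      rw [lintegral_eq_zero_of_ae_eq_zero]
      refine Filter.Eventually.of_forall fun z => indicator_of_notMem ?_ _
      rintro ⟨h0, h1, h2⟩
      exact hx ⟨h0, h1.trans h2⟩
  have hK : Measurable ({p : ℝ × ℝ | 0 < p.1 ∧ p.1 < p.2 ∧ p.2 < 1}.indicator
      (fun p => g p.2 * ENNReal.ofReal p.2⁻¹)) := (hG.comp measurable_snd).indicator hT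
  have hD : Measurable fun x => ∫⁻ z, {p : ℝ × ℝ | 0 < p.1 ∧ p.1 < p.2 ∧ p.2 < 1}.indicator
          (fun p => g p.2 * ENNReal.ofReal p.2⁻¹) (x, z) := hK.lintegral_prod_right'
  refine Measure.ext_of_lintegral _ fun f hf => ?_
  have hmul : Measurable fun p : ℝ × ℝ => p.1 * p.2 := by fun_prop
  have hfm : Measurable fun p : ℝ × ℝ => f (p.1 * p.2) := hf.comp hmul
  rw [hdens, lintegral_withDensity_eq_lintegral_mul _ hD hf, lintegral_map hf hmul,
    lintegral_prod_symm _ hfm.aemeasurable,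
    lintegral_withDensity_eq_lintegral_mul _ hg hfm.lintegral_prod_left']
  calc _ = ∫⁻ z in Ioo (0 : ℝ) 1, g z * (ENNReal.ofReal z⁻¹ * ∫⁻ x in Ioo 0 z, f x) := by
        refine setLIntegral_congr_fun measurableSet_Ioo fun z hz => ?_
        simp only [Pi.mul_apply, lintegral_Icc_comp_mul_right hz.1 hf]
    _ = ∫⁻ z, ∫⁻ x, {p : ℝ × ℝ | 0 < p.1 ∧ p.1 < p.2 ∧ p.2 < 1}.indicator
          (fun p => g p.2 * ENNReal.ofReal p.2⁻¹) (x, z) * f x := by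
        rw [← lintegral_indicator measurableSet_Ioo]
        refine lintegral_congr fun z => ?_
        by_cases hz : z ∈ Ioo (0 : ℝ) 1
        · rw [indicator_of_mem hz, ← mul_assoc, ← lintegral_indicator measurableSet_Ioo,
            ← lintegral_const_mul _ (hf.indicator measurableSet_Ioo)]
          refine lintegral_congr fun x => ?_
          simp [indicator, hz.2]
        · rw [indicator_of_notMem hz]
          symm
          rw [lintegral_eq_zero_of_ae_eq_zero]
          refine Filter.Eventually.of_forall fun x => ?_
          have : (x, z) ∉ {p : ℝ × ℝ | 0 < p.1 ∧ p.1 < p.2 ∧ p.2 < 1} := by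
            rintro ⟨h0, h1, h2⟩
            exact hz ⟨h0.trans h1, h2⟩
          simp only [indicator_of_notMem this, zero_mul, Pi.zero_apply]
    _ = _ := by
        rw [lintegral_lintegral_swap]
        · refine lintegral_congr fun x => ?_
          exact lintegral_mul_const _ (hK.comp measurable_prodMk_left)
        · exact ((hK.comp measurable_swap).mul (hf.comp measurable_snd)).aemeasurable

lemma log_three_lt_two : Real.log 3 < 2 := by
  have := Real.log_lt_sub_one_of_pos (show (0 : ℝ) < 3 by norm_num) (by norm_num)
  linarith

lemma lintegral_Ioo_two_div_mul {c x : ℝ} (hc : 0 < c) (hx : x ∈ Ioo (0 : ℝ) 1) :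
    ∫⁻ z in Ioo x 1, ENNReal.ofReal (2 / (c * (1 + 2 * z)))
      = ENNReal.ofReal (1 / c * Real.log (3 / (1 + 2 * x))) := by
  obtain ⟨h0, h1⟩ := hx
  have hderiv : ∀ z ∈ uIcc x 1,
      HasDerivAt (fun z => 1 / c * Real.log (1 + 2 * z)) (2 / (c * (1 + 2 * z))) z := by
    intro z hz
    rw [uIcc_of_le h1.le] at hz
    have hz' : 0 < 1 + 2 * z := by linarith [hz.1]
    have hlog := ((((hasDerivAt_id' z).const_mul 2).const_add 1).log hz'.ne').const_mul (1 / c)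
    refine hlog.congr_deriv ?_
    field_simp
  have hcont : ContinuousOn (fun z => 2 / (c * (1 + 2 * z))) (uIcc x 1) := by
    refine continuousOn_const.div (by fun_prop) fun z hz => ?_
    rw [uIcc_of_le h1.le] at hz
    have : 0 < 1 + 2 * z := by linarith [hz.1]
    positivity
  have hint := hcont.intervalIntegrable (μ := volume)
  have hftc := intervalIntegral.integral_eq_sub_of_hasDerivAt hderiv hint
  rw [intervalIntegrable_iff_integrableOn_Ioo_of_le h1.le] at hint
  rw [intervalIntegral.integral_of_le h1.le, integral_Ioc_eq_integral_Ioo] at hftc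
  rw [← ofReal_integral_eq_lintegral_ofReal hint, hftc, ← mul_sub,
    ← Real.log_div (by norm_num) (by linarith)]
  · norm_num
  · refine (ae_restrict_iff' measurableSet_Ioo).2 (Filter.Eventually.of_forall fun z hz => ?_)
    have : 0 < 1 + 2 * z := by linarith [hz.1]
    simp only [Pi.zero_apply]
    positivity

theorem density_of_VZ :
    Measure.map (fun p : ℝ × ℝ => p.1 * p.2)
        ((volume.restrict (Icc (0:ℝ) 1)).prod
          ((volume.restrict (Ioo (0:ℝ) 1)).withDensity
            (fun z => ENNReal.ofReal (2 * z / ((1 - Real.log 3 / 2) * (1 + 2 * z))))))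
      = volume.withDensity
          (fun x => ENNReal.ofReal
            (Set.indicator (Ioo (0:ℝ) 1)
              (fun x => (1 / (1 - Real.log 3 / 2)) * Real.log (3 / (1 + 2 * x))) x)) := by
  have hc : 0 < 1 - Real.log 3 / 2 := by linarith [log_three_lt_two]
  rw [map_mul_uniform_prod_withDensity (by fun_prop)]
  congr 1
  ext x
  by_cases hx : x ∈ Ioo (0 : ℝ) 1
  · rw [indicator_of_mem hx, indicator_of_mem hx, ← lintegral_Ioo_two_div_mul hc hx]
    refine setLIntegral_congr_fun measurableSet_Ioo fun z hz => ?_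
    have hz0 : 0 < z := hx.1.trans hz.1
    rw [← ENNReal.ofReal_mul (by positivity)]
    congr 1
    field_simp
  · rw [indicator_of_notMem hx, indicator_of_notMem hx, ENNReal.ofReal_zero]
end

section
/- One has ∫₀¹ ∫₀^∞ ∫₀^∞ (λ·l − x/2)² · (2/√(2π))·(x+l)·exp(−(x+l)²/2) dx dl dλ = 1/3. -/
open MeasureTheory Set

open Filter Topology Real

lemma integrable_exp_neg_sq_div_two : Integrable fun s : ℝ => exp (-s ^ 2 / 2) := by
  refine (integrable_exp_neg_mul_sq (b := 1 / 2) (by norm_num)).congr (ae_of_all _ fun s => ?_)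
  ring_nf

/-- The unnormalised upper tail of the standard Gaussian. -/
noncomputable def gaussianTail (l : ℝ) : ℝ := ∫ s in Ioi l, exp (-s ^ 2 / 2)

lemma gaussianTail_zero : gaussianTail 0 = √(2 * π) / 2 := by
  have h := integral_gaussian_Ioi (1 / 2)
  rw [show π / (1 / 2) = 2 * π by ring] at h
  rw [← h, gaussianTail]
  congr 1
  ext s
  ring_nf

lemma gaussianTail_eq (l : ℝ) :
    gaussianTail l = gaussianTail 0 - ∫ s in (0 : ℝ)..l, exp (-s ^ 2 / 2) := by
  have h := intervalIntegral.integral_interval_add_Ioi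
    (integrable_exp_neg_sq_div_two.integrableOn (s := Ioi 0))
    (integrable_exp_neg_sq_div_two.integrableOn (s := Ioi l))
  rw [gaussianTail, gaussianTail, ← h]
  ring

lemma hasDerivAt_gaussianTail (l : ℝ) :
    HasDerivAt gaussianTail (-exp (-l ^ 2 / 2)) l := by
  have hc : Continuous fun s : ℝ => exp (-s ^ 2 / 2) := by fun_prop
  rw [funext gaussianTail_eq]
  exact (hc.integral_hasStrictDerivAt 0 l).hasDerivAt.const_sub _

lemma hasDerivAt_exp_neg_sq_div_two (s : ℝ) :
    HasDerivAt (fun s : ℝ => exp (-s ^ 2 / 2)) (-s * exp (-s ^ 2 / 2)) s := by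
  have h := (((hasDerivAt_id s).pow 2).neg.div_const 2).exp
  refine h.congr_deriv ?_
  simp
  ring

lemma tendsto_pow_mul_exp_neg_sq_div_two (n : ℕ) :
    Tendsto (fun s : ℝ => s ^ n * exp (-s ^ 2 / 2)) atTop (𝓝 0) := by
  have h := (tendsto_pow_mul_exp_neg_atTop_nhds_zero n).mul_const (exp (1 / 2))
  rw [zero_mul] at h
  refine squeeze_zero' ?_ ?_ h
  · filter_upwards [eventually_ge_atTop 0] with s hs
    positivity
  · filter_upwards [eventually_ge_atTop 0] with s hs
    rw [mul_assoc, ← exp_add]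
    gcongr
    nlinarith [sq_nonneg (s - 1)]

lemma gaussianTail_nonneg (l : ℝ) : 0 ≤ gaussianTail l :=
  integral_nonneg fun _ => (exp_pos _).le

lemma gaussianTail_le_exp {l : ℝ} (hl : 1 ≤ l) : gaussianTail l ≤ exp (-l ^ 2 / 2) := by
  have hd : ∀ x ∈ Ici l, HasDerivAt (fun s : ℝ => -exp (-s ^ 2 / 2)) (x * exp (-x ^ 2 / 2)) x :=
    fun x _ => (hasDerivAt_exp_neg_sq_div_two x).neg.congr_deriv (by ring)
  have hpos : ∀ x ∈ Ioi l, 0 ≤ x * exp (-x ^ 2 / 2) := fun x hx => by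
    have : 0 ≤ x := by linarith [mem_Ioi.1 hx]
    positivity
  have hlim : Tendsto (fun s : ℝ => -exp (-s ^ 2 / 2)) atTop (𝓝 0) := by
    simpa using (tendsto_pow_mul_exp_neg_sq_div_two 0).neg
  have hint := integrableOn_Ioi_deriv_of_nonneg' hd hpos hlim
  have heq := integral_Ioi_of_hasDerivAt_of_nonneg' hd hpos hlim
  calc gaussianTail l ≤ ∫ s in Ioi l, s * exp (-s ^ 2 / 2) :=
        setIntegral_mono_on integrable_exp_neg_sq_div_two.integrableOn hint measurableSet_Ioi
          fun s hs => le_mul_of_one_le_left (exp_pos _).le (hl.trans (mem_Ioi.1 hs).le)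
    _ = exp (-l ^ 2 / 2) := by rw [heq]; ring

lemma tendsto_pow_mul_gaussianTail (n : ℕ) :
    Tendsto (fun l : ℝ => l ^ n * gaussianTail l) atTop (𝓝 0) := by
  refine squeeze_zero' ?_ ?_ (tendsto_pow_mul_exp_neg_sq_div_two n)
  · filter_upwards [eventually_ge_atTop 0] with l hl
    have := gaussianTail_nonneg l
    positivity
  · filter_upwards [eventually_ge_atTop 1] with l hl
    gcongr
    exact gaussianTail_le_exp hl

lemma integral_sq_mul_add_mul_exp (a : ℝ) {l : ℝ} (hl : 0 ≤ l) :
    ∫ x in Ioi (0 : ℝ), (a * l - x / 2) ^ 2 * ((x + l) * exp (-(x + l) ^ 2 / 2)) =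
      a ^ 2 * l ^ 2 * exp (-l ^ 2 / 2) + exp (-l ^ 2 / 2) / 2
        - (a + 1 / 2) * l * gaussianTail l := by
  let F : ℝ → ℝ := fun s => -((a + 1 / 2) * l - s / 2) ^ 2 * exp (-s ^ 2 / 2)
    + (a + 1 / 2) * l * gaussianTail s - exp (-s ^ 2 / 2) / 2
  have hF (s : ℝ) : HasDerivAt F (((a + 1 / 2) * l - s / 2) ^ 2 * (s * exp (-s ^ 2 / 2))) s := by
    have he := hasDerivAt_exp_neg_sq_div_two s
    have hu := ((((hasDerivAt_id s).div_const 2).const_sub ((a + 1 / 2) * l)).pow 2).neg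
    refine (((hu.mul he).add ((hasDerivAt_gaussianTail s).const_mul ((a + 1 / 2) * l))).sub
      (he.div_const 2)).congr_deriv ?_
    simp
    ring
  have hlim : Tendsto F atTop (𝓝 0) := by
    have h0 := tendsto_pow_mul_exp_neg_sq_div_two 0
    have h1 := tendsto_pow_mul_exp_neg_sq_div_two 1
    have h2 := tendsto_pow_mul_exp_neg_sq_div_two 2
    have hq := tendsto_pow_mul_gaussianTail 0
    have h := ((((h0.const_mul (-((a + 1 / 2) * l) ^ 2 - 1 / 2)).add
      (h1.const_mul ((a + 1 / 2) * l))).add (h2.const_mul (-1 / 4))).add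
      (hq.const_mul ((a + 1 / 2) * l)))
    simp only [mul_zero, add_zero] at h
    refine h.congr fun s => ?_
    simp only [F]
    ring
  have hd : ∀ x ∈ Ici (0 : ℝ), HasDerivAt (fun x => F (x + l))
      ((a * l - x / 2) ^ 2 * ((x + l) * exp (-(x + l) ^ 2 / 2))) x :=
    fun x _ => ((hF (x + l)).comp_add_const x l).congr_deriv (by ring)
  have hpos : ∀ x ∈ Ioi (0 : ℝ),
      0 ≤ (a * l - x / 2) ^ 2 * ((x + l) * exp (-(x + l) ^ 2 / 2)) := fun x hx => by
    have : 0 ≤ x + l := add_nonneg (mem_Ioi.1 hx).le hl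
    positivity
  rw [integral_Ioi_of_hasDerivAt_of_nonneg' hd hpos
    (hlim.comp (tendsto_atTop_add_const_right _ l tendsto_id))]
  simp only [F]
  ring_nf

lemma integral_integral_sq_mul_add_mul_exp (a : ℝ) :
    ∫ l in Ioi (0 : ℝ), ∫ x in Ioi (0 : ℝ),
        (a * l - x / 2) ^ 2 * ((x + l) * exp (-(x + l) ^ 2 / 2)) =
      √(2 * π) / 2 * (a ^ 2 - a / 2 + 1 / 4) := by
  let G : ℝ → ℝ := fun l => (1 / 2 * (a + 1 / 2) - a ^ 2) * (l * exp (-l ^ 2 / 2))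
    + (1 / 2 * (a + 1 / 2) - a ^ 2 - 1 / 2) * gaussianTail l
    - (a + 1 / 2) / 2 * (l ^ 2 * gaussianTail l)
  have hG : ∀ l ∈ Ici (0 : ℝ), HasDerivAt G (∫ x in Ioi (0 : ℝ),
      (a * l - x / 2) ^ 2 * ((x + l) * exp (-(x + l) ^ 2 / 2))) l := fun l hl => by
    rw [integral_sq_mul_add_mul_exp a hl]
    have he := hasDerivAt_exp_neg_sq_div_two l
    have hq := hasDerivAt_gaussianTail l
    refine (((((hasDerivAt_id l).mul he).const_mul _).add (hq.const_mul _)).sub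
      ((((hasDerivAt_id l).pow 2).mul hq).const_mul _)).congr_deriv ?_
    simp
    ring
  have hpos : ∀ l ∈ Ioi (0 : ℝ), 0 ≤ ∫ x in Ioi (0 : ℝ),
      (a * l - x / 2) ^ 2 * ((x + l) * exp (-(x + l) ^ 2 / 2)) := fun l hl =>
    setIntegral_nonneg measurableSet_Ioi fun x hx => by
      have : 0 ≤ x + l := add_nonneg (mem_Ioi.1 hx).le (mem_Ioi.1 hl).le
      positivity
  have hlim : Tendsto G atTop (𝓝 0) := by
    have h := (((tendsto_pow_mul_exp_neg_sq_div_two 1).const_mul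
      (1 / 2 * (a + 1 / 2) - a ^ 2)).add ((tendsto_pow_mul_gaussianTail 0).const_mul
      (1 / 2 * (a + 1 / 2) - a ^ 2 - 1 / 2))).sub
      ((tendsto_pow_mul_gaussianTail 2).const_mul ((a + 1 / 2) / 2))
    simpa only [mul_zero, add_zero, sub_zero, pow_one, pow_zero, one_mul] using h
  rw [integral_Ioi_of_hasDerivAt_of_nonneg' hG hpos hlim]
  simp only [G, gaussianTail_zero]
  ring

theorem second_moment_alpha :
    ∫ lam in (0:ℝ)..1, ∫ l in Ioi (0:ℝ), ∫ x in Ioi (0:ℝ),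
        (lam * l - x / 2) ^ 2 *
          ((2 / Real.sqrt (2 * Real.pi)) * (x + l) * Real.exp (-(x + l) ^ 2 / 2))
      = 1 / 3 := by
  have hs : √(2 * π) ≠ 0 := by positivity
  have h (a : ℝ) : ∫ l in Ioi (0 : ℝ), ∫ x in Ioi (0 : ℝ), (a * l - x / 2) ^ 2 *
      ((2 / √(2 * π)) * (x + l) * exp (-(x + l) ^ 2 / 2)) = a ^ 2 - a / 2 + 1 / 4 := by
    simp only [mul_assoc, mul_left_comm _ (2 / √(2 * π)), integral_const_mul]
    rw [integral_integral_sq_mul_add_mul_exp]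
    field_simp
  simp only [h]
  rw [intervalIntegral.integral_add (Continuous.intervalIntegrable (by fun_prop) _ _)
    (Continuous.intervalIntegrable (by fun_prop) _ _),
    intervalIntegral.integral_sub (Continuous.intervalIntegrable (by fun_prop) _ _)
      (Continuous.intervalIntegrable (by fun_prop) _ _)]
  simp only [integral_pow, intervalIntegral.integral_div, integral_id,
    intervalIntegral.integral_const]
  norm_num
end

section
/- For every m > 0, one has ∫₀¹ ∫₀^∞ ∫₀^∞ (max(λ·l − x/2, 0))^m · (2/√(2π))·(x+l)·exp(−(x+l)²/2) dx dl dλ = ( Γ(1+m) / (2^{m/2}·Γ(1+m/2)) ) · 2·∫₀¹ z^{1+m}/(1+2z) dz, where Γ is the classical gamma function. -/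
open MeasureTheory Set

/-- Moments of a centred Gaussian kernel on the half-line. -/
lemma integral_rpow_mul_exp_neg_sq_half {a s : ℝ} (ha : 0 < a) (hs : -1 < s) :
    ∫ l in Ioi (0:ℝ), l ^ s * Real.exp (-(a * l) ^ 2 / 2)
      = a ^ (-(s + 1)) * ((2:ℝ) ^ ((s - 1) / 2) * Real.Gamma ((s + 1) / 2)) := by
  have h := integral_rpow_mul_exp_neg_mul_rpow (p := 2) (q := s) (b := a ^ 2 / 2)
    two_pos hs (by positivity)
  have h₁ : ∫ l in Ioi (0:ℝ), l ^ s * Real.exp (-(a * l) ^ 2 / 2)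
      = ∫ l in Ioi (0:ℝ), l ^ s * Real.exp (-(a ^ 2 / 2) * l ^ (2:ℝ)) := by
    refine integral_congr_ae (Filter.Eventually.of_forall fun l => ?_)
    simp only [Real.rpow_two]
    congr 2
    ring
  have h₂ : (a ^ 2 / 2) ^ (-(s + 1) / 2) = a ^ (-(s + 1)) * (2:ℝ) ^ ((s + 1) / 2) := by
    rw [Real.div_rpow (by positivity) (by positivity), ← Real.rpow_two, ← Real.rpow_mul ha.le,
      neg_div, Real.rpow_neg two_pos.le, div_inv_eq_mul]
    congr 2
    ring
  have h₃ : (2:ℝ) ^ ((s + 1) / 2) = 2 ^ ((s - 1) / 2) * 2 := by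
    rw [← Real.rpow_add_one two_ne_zero]
    congr 1
    ring
  rw [h₁, h, h₂, h₃]
  ring

lemma integral_max_sub_rpow {m a : ℝ} (hm : 0 < m) (ha : 0 ≤ a) (ha' : a ≤ 1) :
    ∫ y in (0:ℝ)..1, (max (y - a) 0) ^ m = (1 - a) ^ (m + 1) / (m + 1) := by
  have hc : Continuous fun y : ℝ => (max (y - a) 0) ^ m :=
    Continuous.rpow_const (by fun_prop) fun _ => Or.inr hm.le
  rw [← intervalIntegral.integral_add_adjacent_intervals (hc.intervalIntegrable 0 a)
    (hc.intervalIntegrable a 1)]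
  have h₁ : ∫ y in (0:ℝ)..a, (max (y - a) 0) ^ m = 0 := by
    rw [intervalIntegral.integral_congr (g := fun _ => (0:ℝ))]
    · simp
    · intro y hy
      rw [uIcc_of_le ha] at hy
      simp only
      rw [max_eq_right (by linarith [hy.2]), Real.zero_rpow hm.ne']
  have h₂ : ∫ y in a..1, (max (y - a) 0) ^ m = ∫ y in a..1, (y - a) ^ m := by
    refine intervalIntegral.integral_congr fun y hy => ?_
    rw [uIcc_of_le ha'] at hy
    rw [max_eq_left (by linarith [hy.1])]
  rw [h₁, h₂, intervalIntegral.integral_comp_sub_right (fun y => y ^ m) a,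
    integral_rpow (Or.inl (by linarith)), sub_self, Real.zero_rpow (by linarith)]
  ring

/-- The Möbius substitution `z = (1 - t / 2) / (1 + t)`. -/
lemma integral_one_sub_half_rpow_mul_rpow {m : ℝ} (hm : 0 < m) :
    ∫ t in (0:ℝ)..2, (1 - t / 2) ^ (m + 1) * (1 + t) ^ (-(m + 2))
      = 2 * ∫ z in (0:ℝ)..1, z ^ (1 + m) / (1 + 2 * z) := by
  have hsub := intervalIntegral.integral_comp_mul_deriv' (a := 0) (b := 2)
    (f := fun t : ℝ => (1 - t / 2) / (1 + t)) (f' := fun t => -(3 / 2) / (1 + t) ^ 2)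
    (g := fun z => z ^ (1 + m) / (1 + 2 * z)) ?_ ?_ ?_
  · norm_num at hsub
    rw [intervalIntegral.integral_symm 1 0, ← hsub, ← intervalIntegral.integral_neg,
      ← intervalIntegral.integral_const_mul]
    refine intervalIntegral.integral_congr fun t ht => ?_
    rw [uIcc_of_le two_pos.le] at ht
    have h₁ : 0 < 1 + t := by linarith [ht.1]
    have h₂ : 0 ≤ 1 - t / 2 := by linarith [ht.2]
    have h₃ : 1 + 2 * ((1 - t / 2) / (1 + t)) = 3 / (1 + t) := by
      field_simp
      ring
    have h₄ : (1 + t) ^ (-(m + 2)) = ((1 + t) ^ (1 + m) * (1 + t))⁻¹ := by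
      rw [← Real.rpow_add_one h₁.ne', Real.rpow_neg h₁.le]
      congr 2
      ring
    rw [h₃, h₄, Real.div_rpow h₂ h₁.le, add_comm m 1]
    have h₅ : (1 + t) ^ (1 + m) ≠ 0 := (Real.rpow_pos_of_pos h₁ _).ne'
    field_simp
  · intro t ht
    rw [uIcc_of_le two_pos.le] at ht
    have h₁ : 1 + t ≠ 0 := by linarith [ht.1]
    have hd := (((hasDerivAt_id t).div_const 2).const_sub 1).div
      ((hasDerivAt_id t).const_add 1) h₁
    refine hd.congr_deriv ?_
    simp only [id]
    field_simp
    ring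
  · intro t ht
    rw [uIcc_of_le two_pos.le] at ht
    have h₁ : (1 + t) ^ 2 ≠ 0 := by nlinarith [ht.1]
    exact ContinuousAt.continuousWithinAt (by fun_prop (disch := assumption))
  · rintro z ⟨t, ht, rfl⟩
    rw [uIcc_of_le two_pos.le] at ht
    have h₁ : 0 ≤ (1 - t / 2) / (1 + t) :=
      div_nonneg (by linarith [ht.2]) (by linarith [ht.1])
    refine ContinuousAt.continuousWithinAt ?_
    refine ContinuousAt.div (continuousAt_id.rpow_const (Or.inr (by linarith))) (by fun_prop) ?_
    positivity

lemma integral_integral_max_sub_rpow {m : ℝ} (hm : 0 < m) :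
    ∫ y in (0:ℝ)..1, ∫ t in Ioc (0:ℝ) 2, (max (y - t / 2) 0) ^ m * (1 + t) ^ (-(m + 2))
      = (2 * ∫ z in (0:ℝ)..1, z ^ (1 + m) / (1 + 2 * z)) / (m + 1) := by
  rw [intervalIntegral_integral_swap]
  · rw [← integral_one_sub_half_rpow_mul_rpow hm, ← intervalIntegral.integral_div,
      intervalIntegral.integral_of_le two_pos.le]
    refine setIntegral_congr_fun measurableSet_Ioc fun t ht => ?_
    rw [intervalIntegral.integral_mul_const,
      integral_max_sub_rpow hm (by linarith [ht.1]) (by linarith [ht.2])]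
    ring
  · rw [uIoc_of_le zero_le_one, Measure.prod_restrict]
    refine IntegrableOn.mono_set (t := Icc 0 1 ×ˢ Icc 0 2) ?_
      (prod_mono Ioc_subset_Icc_self Ioc_subset_Icc_self)
    refine ContinuousOn.integrableOn_compact (isCompact_Icc.prod isCompact_Icc) ?_
    rintro ⟨y, t⟩ ⟨-, ht⟩
    refine ContinuousAt.continuousWithinAt (ContinuousAt.mul ?_ ?_)
    · exact ContinuousAt.rpow_const (by fun_prop) (Or.inr hm.le)
    · exact ContinuousAt.rpow_const (by fun_prop) (Or.inl (by simp at ht ⊢; linarith [ht.1]))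

/-- The substitution `x = l * t` in the inner integral. -/
lemma integral_max_mul_sub_rpow_mul {m y l c : ℝ} (hm : 0 < m) (hy : y ≤ 1) (hl : 0 < l) :
    ∫ x in Ioi (0:ℝ), (max (y * l - x / 2) 0) ^ m *
          (c * (x + l) * Real.exp (-(x + l) ^ 2 / 2))
      = ∫ t in Ioc (0:ℝ) 2, (max (y - t / 2) 0) ^ m * (c * (1 + t)) *
          (l ^ (m + 2) * Real.exp (-((1 + t) * l) ^ 2 / 2)) := by
  have h := integral_comp_mul_left_Ioi (fun x => (max (y * l - x / 2) 0) ^ m *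
          (c * (x + l) * Real.exp (-(x + l) ^ 2 / 2))) 0 hl
  rw [mul_zero, smul_eq_mul, eq_inv_mul_iff_mul_eq₀ hl.ne', ← integral_const_mul] at h
  rw [← h, ← setIntegral_eq_of_subset_of_forall_sdiff_eq_zero measurableSet_Ioi
    (show Ioc (0:ℝ) 2 ⊆ Ioi 0 from Ioc_subset_Ioi_self)]
  · refine setIntegral_congr_fun measurableSet_Ioi fun t _ => ?_
    have h₁ : max (y * l - l * t / 2) 0 = max (y - t / 2) 0 * l := by
      rw [max_mul_of_nonneg _ _ hl.le, zero_mul]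
      congr 1
      ring
    rw [h₁, Real.mul_rpow (le_max_right _ _) hl.le, Real.rpow_add hl, Real.rpow_two,
      show l * t + l = (1 + t) * l by ring]
    ring
  · rintro t ⟨ht, ht'⟩
    have h₂ : 2 < t := by
      by_contra hcon
      exact ht' ⟨ht, not_lt.mp hcon⟩
    rw [max_eq_right (by linarith), Real.zero_rpow hm.ne', zero_mul, zero_mul]

lemma integrable_max_sub_rpow_mul_gaussian {m y c : ℝ} (hm : 0 < m) :
    Integrable (Function.uncurry fun l t : ℝ => (max (y - t / 2) 0) ^ m * (c * (1 + t)) *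
        (l ^ (m + 2) * Real.exp (-((1 + t) * l) ^ 2 / 2)))
      ((volume.restrict (Ioi 0)).prod (volume.restrict (Ioc 0 2))) := by
  have h₁ : IntegrableOn (fun l : ℝ => l ^ (m + 2) * Real.exp (-(1 / 2) * l ^ 2)) (Ioi 0) :=
    integrableOn_rpow_mul_exp_neg_mul_sq (by norm_num) (by linarith)
  have hc : Continuous fun t : ℝ => (max (y - t / 2) 0) ^ m * (c * (1 + t)) :=
    (Continuous.rpow_const (by fun_prop) fun _ => Or.inr hm.le).mul (by fun_prop)
  have h₂ : IntegrableOn (fun t : ℝ => ‖(max (y - t / 2) 0) ^ m * (c * (1 + t))‖) (Ioc 0 2) :=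
    (hc.norm.continuousOn.integrableOn_Icc).mono_set Ioc_subset_Icc_self
  refine (h₁.mul_prod h₂).mono' ?_ ?_
  · refine Continuous.aestronglyMeasurable ?_
    refine (hc.comp continuous_snd).mul (Continuous.mul ?_ (by fun_prop))
    exact continuous_fst.rpow_const fun _ => Or.inr (by linarith)
  · rw [Measure.prod_restrict]
    refine (ae_restrict_iff' (measurableSet_Ioi.prod measurableSet_Ioc)).mpr
      (Filter.Eventually.of_forall ?_)
    rintro ⟨l, t⟩ ⟨hl, ht⟩
    simp only [mem_Ioi, mem_Ioc] at hl ht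
    simp only [Function.uncurry]
    rw [norm_mul, mul_comm]
    refine mul_le_mul_of_nonneg_right ?_ (norm_nonneg _)
    rw [Real.norm_of_nonneg (by positivity)]
    gcongr
    nlinarith [sq_nonneg l, mul_nonneg (sq_nonneg l) ht.1.le, sq_nonneg (l * t)]

lemma integral_integral_max_mul_sub_rpow_mul {m y c : ℝ} (hm : 0 < m) (hy : y ≤ 1) :
    ∫ l in Ioi (0:ℝ), ∫ x in Ioi (0:ℝ), (max (y * l - x / 2) 0) ^ m *
          (c * (x + l) * Real.exp (-(x + l) ^ 2 / 2))
      = c * ((2:ℝ) ^ ((m + 1) / 2) * Real.Gamma ((m + 3) / 2)) *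
          ∫ t in Ioc (0:ℝ) 2, (max (y - t / 2) 0) ^ m * (1 + t) ^ (-(m + 2)) := by
  rw [setIntegral_congr_fun measurableSet_Ioi
      (fun l hl => integral_max_mul_sub_rpow_mul hm hy hl),
    integral_integral_swap (integrable_max_sub_rpow_mul_gaussian hm), ← integral_const_mul]
  refine setIntegral_congr_fun measurableSet_Ioc fun t ht => ?_
  have h₁ : 0 < 1 + t := by linarith [ht.1]
  have h₂ : (1 + t) ^ (-(m + 2)) = (1 + t) ^ (-(m + 2 + 1)) * (1 + t) := by
    rw [← Real.rpow_add_one h₁.ne']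
    congr 1
    ring
  rw [integral_const_mul, integral_rpow_mul_exp_neg_sq_half h₁ (by linarith), h₂,
    show (m + 2 - 1) / 2 = (m + 1) / 2 by ring, show (m + 2 + 1) / 2 = (m + 3) / 2 by ring]
  ring

/-- Two expressions for the absolute moment of order `m` of a standard Gaussian. -/
lemma gaussian_moment_eq_gamma_div {m : ℝ} (hm : 0 < m) :
    (2 / Real.sqrt (2 * Real.pi)) * ((2:ℝ) ^ ((m + 1) / 2) * Real.Gamma ((m + 3) / 2)) / (m + 1)
      = Real.Gamma (1 + m) / ((2:ℝ) ^ (m / 2) * Real.Gamma (1 + m / 2)) := by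
  have hG : 0 < Real.Gamma (1 + m / 2) := Real.Gamma_pos_of_pos (by linarith)
  have hdup := Real.Gamma_mul_Gamma_add_half ((m + 1) / 2)
  rw [show (m + 1) / 2 + 1 / 2 = 1 + m / 2 by ring, show 2 * ((m + 1) / 2) = 1 + m by ring,
    show 1 - (1 + m) = -(m / 2 + m / 2) by ring, Real.rpow_neg two_pos.le,
    Real.rpow_add two_pos] at hdup
  have hrec : Real.Gamma ((m + 3) / 2) = (m + 1) / 2 * Real.Gamma ((m + 1) / 2) := by
    rw [← Real.Gamma_add_one (by linarith)]
    congr 1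
    ring
  have hpow : (2:ℝ) ^ ((m + 1) / 2) = 2 ^ (m / 2) * Real.sqrt 2 := by
    rw [Real.sqrt_eq_rpow, ← Real.rpow_add two_pos]
    congr 1
    ring
  have hp : (0:ℝ) < 2 ^ (m / 2) := by positivity
  have hpi : 0 < Real.sqrt Real.pi := Real.sqrt_pos.mpr Real.pi_pos
  rw [hrec, hpow, Real.sqrt_mul two_pos.le]
  field_simp at hdup ⊢
  linear_combination hdup

theorem mellin_positive_part_alpha (m : ℝ) (hm : 0 < m) :
    ∫ lam in (0:ℝ)..1, ∫ l in Ioi (0:ℝ), ∫ x in Ioi (0:ℝ),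
        (max (lam * l - x / 2) 0) ^ m *
          ((2 / Real.sqrt (2 * Real.pi)) * (x + l) * Real.exp (-(x + l) ^ 2 / 2))
      = (Real.Gamma (1 + m) / ((2:ℝ) ^ (m / 2) * Real.Gamma (1 + m / 2))) *
          (2 * ∫ z in (0:ℝ)..1, z ^ (1 + m) / (1 + 2 * z)) := by
  rw [intervalIntegral.integral_congr fun y hy =>
      integral_integral_max_mul_sub_rpow_mul hm (uIcc_of_le (zero_le_one' ℝ) ▸ hy).2,
    intervalIntegral.integral_const_mul, integral_integral_max_sub_rpow hm,
    ← gaussian_moment_eq_gamma_div hm]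
  ring
end

section
/- For every m > 0, one has ∫₀¹ ∫₀^∞ ∫₀^∞ (max(x/2 − λ·l, 0))^m · (2/√(2π))·(x+l)·exp(−(x+l)²/2) dx dl dλ = ( Γ(1+m) / (2^{m/2}·Γ(1+m/2)) ) · (log 3) / 2^{m+1}, where Γ is the classical gamma function. -/
open MeasureTheory Set

lemma integrableOn_max_sub_mul_rpow {m : ℝ} (hm : 0 < m) (a : ℝ) {b : ℝ} (hb : 0 < b) :
    IntegrableOn (fun l : ℝ => (max (a - b * l) 0) ^ m) (Ioi 0) := by
  have hcont : Continuous (fun l : ℝ => (max (a - b * l) 0) ^ m) :=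
    (by fun_prop : Continuous fun l : ℝ => max (a - b * l) 0).rpow_const fun _ => Or.inr hm.le
  have hIoc : IntegrableOn (fun l : ℝ => (max (a - b * l) 0) ^ m) (Ioc 0 (a / b)) :=
    (hcont.integrableOn_Icc).mono_set Ioc_subset_Icc_self
  refine hIoc.of_forall_sdiff_eq_zero measurableSet_Ioi fun l hl => ?_
  have h : a / b < l := by
    by_contra! h
    exact hl.2 ⟨hl.1, h⟩
  rw [div_lt_iff₀ hb] at h
  rw [max_eq_right (by linarith), Real.zero_rpow hm.ne']

lemma integral_Ioi_max_sub_mul_rpow {m : ℝ} (hm : 0 < m) {a b : ℝ} (ha : 0 < a) (hb : 0 < b) :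
    ∫ l in Ioi (0:ℝ), (max (a - b * l) 0) ^ m = a ^ (m + 1) / ((m + 1) * b) := by
  have hsub : ∫ l in Ioi (0:ℝ), (max (a - b * l) 0) ^ m
      = ∫ l in Ioc (0:ℝ) (a / b), (a - b * l) ^ m := by
    rw [setIntegral_eq_of_subset_of_forall_sdiff_eq_zero (s := Ioc (0:ℝ) (a / b))
      measurableSet_Ioi (fun l hl => hl.1)]
    · refine setIntegral_congr_fun measurableSet_Ioc fun l hl => ?_
      have h := (le_div_iff₀ hb).1 hl.2
      rw [max_eq_left (by linarith)]
    · intro l hl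
      have h : a / b < l := by
        by_contra! h
        exact hl.2 ⟨hl.1, h⟩
      rw [div_lt_iff₀ hb] at h
      rw [max_eq_right (by linarith), Real.zero_rpow hm.ne']
  rw [hsub, ← intervalIntegral.integral_of_le (by positivity),
    intervalIntegral.integral_comp_sub_mul (fun x => x ^ m) hb.ne',
    integral_rpow (Or.inl (by linarith)), mul_div_cancel₀ _ hb.ne', sub_self, mul_zero, sub_zero,
    Real.zero_rpow (by linarith), sub_zero, smul_eq_mul]
  field_simp

lemma setIntegral_Ioi_comp_add_right (f : ℝ → ℝ) (l : ℝ) :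
    ∫ x in Ioi (0:ℝ), f (x + l) = ∫ s in Ioi l, f s := by
  have h := (measurePreserving_add_right (volume : Measure ℝ) l).setIntegral_preimage_emb
    (measurableEmbedding_addRight l) f (Ioi l)
  simpa using h

lemma integral_Ioi_rpow_mul_exp_neg_sq_div_two {q : ℝ} (hq : -1 < q) :
    ∫ s in Ioi (0:ℝ), s ^ q * Real.exp (-s ^ 2 / 2)
      = (2:ℝ) ^ ((q - 1) / 2) * Real.Gamma ((q + 1) / 2) := by
  have h := integral_rpow_mul_exp_neg_mul_rpow (p := 2) (q := q) (b := 1 / 2) two_pos hq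
    (by norm_num)
  have hexp : ∀ s : ℝ, -s ^ 2 / 2 = -(1 / 2) * s ^ (2:ℝ) := fun s => by
    rw [Real.rpow_two]; ring
  simp_rw [hexp]
  rw [h, one_div, Real.inv_rpow two_pos.le, ← Real.rpow_neg two_pos.le, ← Real.rpow_neg_one 2,
    ← Real.rpow_add two_pos]
  congr 2
  ring

lemma integrableOn_Ioi_rpow_mul_exp_neg_sq_div_two {q : ℝ} (hq : -1 < q) :
    IntegrableOn (fun s : ℝ => s ^ q * Real.exp (-s ^ 2 / 2)) (Ioi 0) := by
  refine (integrableOn_rpow_mul_exp_neg_mul_sq (b := 1 / 2) (by norm_num) hq).congr_fun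
    (fun s _ => ?_) measurableSet_Ioi
  simp only
  congr 2
  ring

/-- The inner integral over the quadrant, after the change of variables `s = x + l`. -/
lemma integral_integral_max_rpow_mul_exp {m : ℝ} (hm : 0 < m) (c : ℝ) {lam : ℝ} (hlam : 0 ≤ lam) :
    ∫ l in Ioi (0:ℝ), ∫ x in Ioi (0:ℝ),
        (max (x / 2 - lam * l) 0) ^ m * (c * (x + l) * Real.exp (-(x + l) ^ 2 / 2))
      = c * ((2:ℝ) ^ ((m + 1) / 2) * Real.Gamma ((m + 3) / 2))
          / ((2:ℝ) ^ (m + 1) * (m + 1)) * (lam + 1 / 2)⁻¹ := by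
  set b := lam + 1 / 2 with hb_def
  have hb : 0 < b := by positivity
  let F : ℝ → ℝ → ℝ := fun l s =>
    (max (s / 2 - b * l) 0) ^ m * (c * s * Real.exp (-s ^ 2 / 2))
  have hshift : ∀ l ∈ Ioi (0:ℝ), (∫ x in Ioi (0:ℝ),
      (max (x / 2 - lam * l) 0) ^ m * (c * (x + l) * Real.exp (-(x + l) ^ 2 / 2)))
      = ∫ s in Ioi (0:ℝ), F l s := by
    intro l hl
    rw [mem_Ioi] at hl
    have h1 : ∀ x : ℝ, (max (x / 2 - lam * l) 0) ^ m *
        (c * (x + l) * Real.exp (-(x + l) ^ 2 / 2)) = F l (x + l) := fun x => by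
      have : x / 2 - lam * l = (x + l) / 2 - b * l := by rw [hb_def]; ring
      simp only [F, this]
    simp_rw [h1]
    rw [setIntegral_Ioi_comp_add_right (F l) l]
    refine (setIntegral_eq_of_subset_of_forall_sdiff_eq_zero measurableSet_Ioi
      (Ioi_subset_Ioi hl.le) fun s hs => ?_).symm
    have hs' : s ≤ l := not_lt.1 hs.2
    have : 0 ≤ lam * l := by positivity
    have : s / 2 - b * l ≤ 0 := by rw [hb_def]; linarith
    simp only [F, max_eq_right this, Real.zero_rpow hm.ne', zero_mul]
  have hinner : ∀ (d s : ℝ), s ∈ Ioi (0:ℝ) →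
      ∫ l in Ioi (0:ℝ), (max (s / 2 - b * l) 0) ^ m * (d * s * Real.exp (-s ^ 2 / 2))
      = d / ((2:ℝ) ^ (m + 1) * (m + 1) * b) * (s ^ (m + 2) * Real.exp (-s ^ 2 / 2)) := by
    intro d s hs
    rw [mem_Ioi] at hs
    rw [integral_mul_const, integral_Ioi_max_sub_mul_rpow hm (half_pos hs) hb,
      Real.div_rpow hs.le two_pos.le, show m + 2 = m + 1 + 1 by ring, Real.rpow_add_one hs.ne' (m + 1)]
    field_simp
  have hcont : Continuous (Function.uncurry F) := by
    refine Continuous.mul ?_ (by fun_prop)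
    exact (by fun_prop : Continuous fun p : ℝ × ℝ => max (p.2 / 2 - b * p.1) 0).rpow_const
      fun _ => Or.inr hm.le
  have hint : Integrable (Function.uncurry F)
      ((volume.restrict (Ioi (0:ℝ))).prod (volume.restrict (Ioi (0:ℝ)))) := by
    rw [integrable_prod_iff' hcont.aestronglyMeasurable]
    constructor
    · exact Filter.Eventually.of_forall fun s =>
        (integrableOn_max_sub_mul_rpow hm (s / 2) hb).integrable.mul_const
          (c * s * Real.exp (-s ^ 2 / 2))
    · have hg := (integrableOn_Ioi_rpow_mul_exp_neg_sq_div_two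
        (q := m + 2) (by linarith)).const_mul (|c| / ((2:ℝ) ^ (m + 1) * (m + 1) * b))
      refine IntegrableOn.congr_fun hg (fun s hs => ?_) measurableSet_Ioi
      rw [← hinner |c| s hs]
      refine integral_congr_ae (Filter.Eventually.of_forall fun l => ?_)
      simp only [Function.uncurry_apply_pair, F, norm_mul, Real.norm_eq_abs, Real.abs_exp,
        abs_of_pos (mem_Ioi.1 hs),
        abs_of_nonneg (Real.rpow_nonneg (le_max_right (s / 2 - b * l) 0) m)]
  rw [setIntegral_congr_fun measurableSet_Ioi hshift, integral_integral_swap hint,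
    setIntegral_congr_fun measurableSet_Ioi (hinner c), integral_const_mul,
    integral_Ioi_rpow_mul_exp_neg_sq_div_two (by linarith),
    show m + 2 - 1 = m + 1 by ring, show m + 2 + 1 = m + 3 by ring]
  field_simp

lemma integral_inv_add_half : ∫ lam in (0:ℝ)..1, (lam + 1 / 2)⁻¹ = Real.log 3 := by
  rw [intervalIntegral.integral_comp_add_right (fun x : ℝ => x⁻¹),
    integral_inv_of_pos (by norm_num) (by norm_num)]
  norm_num

/-- Two expressions for the absolute moment of order `m` of a standard Gaussian variable. -/
lemma gaussian_abs_moment_eq {m : ℝ} (hm : 0 < m) :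
    2 / Real.sqrt (2 * Real.pi) * ((2:ℝ) ^ ((m + 1) / 2) * Real.Gamma ((m + 3) / 2)) / (m + 1)
      = Real.Gamma (1 + m) / ((2:ℝ) ^ (m / 2) * Real.Gamma (1 + m / 2)) := by
  have hdup := Real.Gamma_mul_Gamma_add_half ((m + 1) / 2)
  rw [show (m + 1) / 2 + 1 / 2 = 1 + m / 2 by ring, show 2 * ((m + 1) / 2) = 1 + m by ring,
    show 1 - (1 + m) = -m by ring, Real.rpow_neg two_pos.le] at hdup
  have hG : 0 < Real.Gamma (1 + m / 2) := Real.Gamma_pos_of_pos (by positivity)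
  have hpow : (2:ℝ) ^ m = 2 ^ (m / 2) * 2 ^ (m / 2) := by
    rw [← Real.rpow_add two_pos, add_halves]
  have hhalf : (2:ℝ) ^ ((m + 1) / 2) = 2 ^ (m / 2) * Real.sqrt 2 := by
    rw [Real.sqrt_eq_rpow, ← Real.rpow_add two_pos]
    congr 1
    ring
  have hsucc : Real.Gamma ((m + 3) / 2) = (m + 1) / 2 * Real.Gamma ((m + 1) / 2) := by
    rw [← Real.Gamma_add_one (by positivity)]
    congr 1
    ring
  have hpi : 0 < Real.sqrt Real.pi := Real.sqrt_pos.2 Real.pi_pos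
  have h2 : 0 < (2:ℝ) ^ (m / 2) := by positivity
  rw [hpow] at hdup
  rw [hsucc, hhalf, Real.sqrt_mul two_pos.le]
  field_simp at hdup ⊢
  linarith

theorem mellin_negative_part_alpha (m : ℝ) (hm : 0 < m) :
    ∫ lam in (0:ℝ)..1, ∫ l in Ioi (0:ℝ), ∫ x in Ioi (0:ℝ),
        (max (x / 2 - lam * l) 0) ^ m *
          ((2 / Real.sqrt (2 * Real.pi)) * (x + l) * Real.exp (-(x + l) ^ 2 / 2))
      = (Real.Gamma (1 + m) / ((2:ℝ) ^ (m / 2) * Real.Gamma (1 + m / 2))) *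
          Real.log 3 / (2:ℝ) ^ (m + 1) := by
  have hinner : EqOn (fun lam : ℝ => ∫ l in Ioi (0:ℝ), ∫ x in Ioi (0:ℝ),
        (max (x / 2 - lam * l) 0) ^ m *
          ((2 / Real.sqrt (2 * Real.pi)) * (x + l) * Real.exp (-(x + l) ^ 2 / 2)))
      (fun lam => 2 / Real.sqrt (2 * Real.pi) *
        ((2:ℝ) ^ ((m + 1) / 2) * Real.Gamma ((m + 3) / 2))
          / ((2:ℝ) ^ (m + 1) * (m + 1)) * (lam + 1 / 2)⁻¹) (uIcc 0 1) := fun lam hlam => by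
    rw [uIcc_of_le zero_le_one] at hlam
    exact integral_integral_max_rpow_mul_exp hm _ hlam.1
  rw [intervalIntegral.integral_congr hinner, intervalIntegral.integral_const_mul,
    integral_inv_add_half, ← gaussian_abs_moment_eq hm]
  field_simp
end

section
/- Let 0 < c ≤ 1. The pushforward of the uniform probability measure on [0,1]² under the map (λ,u) ↦ λ·u − c·(1−u) has density u_c(x) with respect to Lebesgue measure on ℝ, where u_c(x) = log(1 + 1/c) for −c ≤ x ≤ 0, u_c(x) = log((1+c)/(x+c)) for 0 ≤ x ≤ 1, and u_c(x) = 0 for x < −c or x > 1. -/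
open MeasureTheory Set

lemma setLIntegral_inv_add_Icc {a b c : ℝ} (hab : a ≤ b) (hac : 0 < a + c) :
    ∫⁻ t in Icc a b, ENNReal.ofReal (t + c)⁻¹ =
      ENNReal.ofReal (Real.log ((b + c) / (a + c))) := by
  have hpos : ∀ t ∈ Icc a b, 0 < t + c := fun t ht => by linarith [ht.1]
  have hint : IntegrableOn (fun t : ℝ => (t + c)⁻¹) (Icc a b) :=
    ContinuousOn.integrableOn_Icc <|
      ContinuousOn.inv₀ (by fun_prop) fun t ht => (hpos t ht).ne'
  rw [← ofReal_integral_eq_lintegral_ofReal hint, integral_Icc_eq_integral_Ioc,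
    ← intervalIntegral.integral_of_le hab,
    intervalIntegral.integral_comp_add_right (fun t : ℝ => t⁻¹) c,
    integral_inv_of_pos hac (by linarith)]
  filter_upwards [ae_restrict_mem measurableSet_Icc] with t ht
  exact (inv_pos.2 (hpos t ht)).le

lemma volume_restrict_Icc_preimage_affine {a c : ℝ} (hac : 0 < a + c) (s : Set ℝ)
    (hs : MeasurableSet s) :
    volume.restrict (Icc (0 : ℝ) 1) ((fun t : ℝ => a * t - c * (1 - t)) ⁻¹' s) =
      ∫⁻ x in s, (Icc (-c) a).indicator (fun _ => ENNReal.ofReal (a + c)⁻¹) x := by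
  have hset : ((fun t : ℝ => a * t - c * (1 - t)) ⁻¹' s) ∩ Icc 0 1 =
      ((a + c) * ·) ⁻¹' ((· + -c) ⁻¹' (Icc (-c) a ∩ s)) := by
    ext t
    have hval : a * t - c * (1 - t) = (a + c) * t + -c := by ring
    simp only [mem_inter_iff, mem_preimage, mem_Icc, hval]
    have h0 : 0 ≤ t ↔ -c ≤ (a + c) * t + -c := by
      rw [← mul_nonneg_iff_of_pos_left hac]; constructor <;> intro h <;> linarith
    have h1 : t ≤ 1 ↔ (a + c) * t + -c ≤ a := by
      rw [← mul_le_mul_iff_right₀ hac]; constructor <;> intro h <;> linarith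
    rw [h0, h1, and_comm]
  rw [Measure.restrict_apply (hs.preimage (by fun_prop)), hset,
    Real.volume_preimage_mul_left hac.ne', measure_preimage_add_right,
    abs_of_pos (inv_pos.2 hac), lintegral_indicator_const measurableSet_Icc,
    Measure.restrict_apply measurableSet_Icc]

theorem density_of_A_c (c : ℝ) (hc0 : 0 < c) (hc1 : c ≤ 1) (u : ℝ → ℝ)
    (h1 : ∀ x : ℝ, -c ≤ x → x ≤ 0 → u x = Real.log (1 + 1 / c))
    (h2 : ∀ x : ℝ, 0 ≤ x → x ≤ 1 → u x = Real.log ((1 + c) / (x + c)))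
    (h3 : ∀ x : ℝ, x < -c ∨ 1 < x → u x = 0) :
    Measure.map (fun p : ℝ × ℝ => p.1 * p.2 - c * (1 - p.2))
        (volume.restrict (Icc (0:ℝ) 1 ×ˢ Icc (0:ℝ) 1))
      = volume.withDensity (fun x => ENNReal.ofReal (u x)) := by
  have hmeas : Measurable fun p : ℝ × ℝ => p.1 * p.2 - c * (1 - p.2) := by fun_prop
  have hdensity : ∀ x : ℝ, ∫⁻ l in Icc (0 : ℝ) 1,
      (Icc (-c) l).indicator (fun _ => ENNReal.ofReal (l + c)⁻¹) x = ENNReal.ofReal (u x) := by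
    intro x
    by_cases hx : x < -c ∨ 1 < x
    · rw [h3 x hx, ENNReal.ofReal_zero]
      refine setLIntegral_eq_zero measurableSet_Icc fun l hl => indicator_of_notMem ?_ _
      rintro ⟨hcx, hxl⟩
      rcases hx with hx | hx <;> linarith [hl.2]
    · push Not at hx
      have hux : u x = Real.log ((1 + c) / (max x 0 + c)) := by
        rcases le_total x 0 with h | h
        · rw [h1 x hx.1 h, max_eq_right h]
          congr 1
          field_simp
          ring
        · rw [h2 x h hx.2, max_eq_left h]
      have hind : ∀ l : ℝ, (Icc (-c) l).indicator (fun _ => ENNReal.ofReal (l + c)⁻¹) x =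
          (Ici x).indicator (fun l => ENNReal.ofReal (l + c)⁻¹) l := by
        intro l
        simp [indicator_apply, hx.1]
      have hIcc : Ici x ∩ Icc 0 1 = Icc (max x 0) 1 := by
        ext l
        simp [and_assoc]
      simp_rw [hind]
      rw [setLIntegral_indicator measurableSet_Ici, hIcc,
        setLIntegral_inv_add_Icc (max_le hx.2 zero_le_one) (by positivity), hux]
  have hjoint : Measurable (Function.uncurry fun l x : ℝ =>
      (Icc (-c) l).indicator (fun _ => ENNReal.ofReal (l + c)⁻¹) x) := by
    have hset : MeasurableSet {p : ℝ × ℝ | -c ≤ p.2 ∧ p.2 ≤ p.1} :=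
      (measurableSet_le measurable_const measurable_snd).inter
        (measurableSet_le measurable_snd measurable_fst)
    exact Measurable.indicator (f := fun p : ℝ × ℝ => ENNReal.ofReal (p.1 + c)⁻¹)
      (by fun_prop) hset
  ext s hs
  rw [Measure.map_apply hmeas hs, withDensity_apply _ hs, Measure.volume_eq_prod,
    ← Measure.prod_restrict, Measure.prod_apply (hmeas hs)]
  calc
    _ = ∫⁻ l in Icc (0 : ℝ) 1, ∫⁻ x in s,
        (Icc (-c) l).indicator (fun _ => ENNReal.ofReal (l + c)⁻¹) x :=
      setLIntegral_congr_fun measurableSet_Icc fun l hl =>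
        volume_restrict_Icc_preimage_affine (by linarith [hl.1]) s hs
    _ = _ := by
      rw [lintegral_lintegral_swap hjoint.aemeasurable]
      simp_rw [hdensity]
end

section
/- For every c with 0 < c ≤ 1, the two-dimensional Lebesgue measure of the set {(λ,u) ∈ [0,1]×[0,1] : λ·u > c·(1−u)} equals 1 − c·log(1 + 1/c). -/
open MeasureTheory Set

theorem integral_one_sub_div_add {c : ℝ} (hc : 0 < c) :
    ∫ x in (0:ℝ)..1, (1 - c / (x + c)) = 1 - c * Real.log (1 + 1 / c) := by
  have hne : ∀ x ∈ uIcc (0:ℝ) 1, x + c ≠ 0 := by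
    intro x hx
    rw [uIcc_of_le zero_le_one] at hx
    linarith [hx.1]
  have hderiv : ∀ x ∈ uIcc (0:ℝ) 1,
      HasDerivAt (fun x => x - c * Real.log (x + c)) (1 - c / (x + c)) x := by
    intro x hx
    have h := (hasDerivAt_id x).sub
      ((((hasDerivAt_id x).add_const c).log (hne x hx)).const_mul c)
    exact h.congr_deriv (by simp [div_eq_mul_inv])
  have hcont : ContinuousOn (fun x : ℝ => 1 - c / (x + c)) (uIcc 0 1) :=
    continuousOn_const.sub
      (continuousOn_const.div (continuousOn_id.add continuousOn_const) hne)
  rw [intervalIntegral.integral_eq_sub_of_hasDerivAt hderiv hcont.intervalIntegrable,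
    show 1 + 1 / c = (1 + c) / c by field_simp; ring,
    Real.log_div (by positivity) hc.ne', zero_add]
  ring

theorem slice_eq_Ioc {c x : ℝ} (hc : 0 < c) (hx : x ∈ Icc (0:ℝ) 1) :
    {u : ℝ | u ∈ Icc (0:ℝ) 1 ∧ x * u > c * (1 - u)} = Ioc (c / (x + c)) 1 := by
  have hpos : 0 < x + c := by linarith [hx.1]
  ext u
  simp only [mem_ofPred_eq, mem_Icc, mem_Ioc, div_lt_iff₀ hpos]
  constructor
  · rintro ⟨⟨-, h1⟩, h⟩
    exact ⟨by linarith, h1⟩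
  · rintro ⟨h, h1⟩
    exact ⟨⟨(pos_of_mul_pos_left (hc.trans h) hpos.le).le, h1⟩, by linarith⟩

theorem prob_A_c_pos (c : ℝ) (hc0 : 0 < c) (hc1 : c ≤ 1) :
    volume {p : ℝ × ℝ | p ∈ Icc (0:ℝ) 1 ×ˢ Icc (0:ℝ) 1 ∧ p.1 * p.2 > c * (1 - p.2)}
      = ENNReal.ofReal (1 - c * Real.log (1 + 1 / c)) := by
  have hmeas : MeasurableSet
      {p : ℝ × ℝ | p ∈ Icc (0:ℝ) 1 ×ˢ Icc (0:ℝ) 1 ∧ p.1 * p.2 > c * (1 - p.2)} :=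
    (measurableSet_Icc.prod measurableSet_Icc).inter
      (measurableSet_lt (f := fun p : ℝ × ℝ => c * (1 - p.2)) (g := fun p => p.1 * p.2)
        (by fun_prop) (by fun_prop))
  have hslice : (fun x : ℝ => volume (Prod.mk x ⁻¹'
      {p : ℝ × ℝ | p ∈ Icc (0:ℝ) 1 ×ˢ Icc (0:ℝ) 1 ∧ p.1 * p.2 > c * (1 - p.2)}))
      = (Icc (0:ℝ) 1).indicator fun x => ENNReal.ofReal (1 - c / (x + c)) := by
    funext x
    by_cases hx : x ∈ Icc (0:ℝ) 1
    · rw [indicator_of_mem hx, ← Real.volume_Ioc, ← slice_eq_Ioc hc0 hx]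
      congr 1
      ext u
      simp only [mem_preimage, mem_ofPred_eq, mem_prod, hx, true_and]
    · rw [indicator_of_notMem hx]
      convert measure_empty (μ := (volume : Measure ℝ))
      ext u
      simp only [mem_preimage, mem_ofPred_eq, mem_prod, hx, false_and, mem_empty_iff_false]
  have hcont : ContinuousOn (fun x : ℝ => 1 - c / (x + c)) (Icc 0 1) :=
    continuousOn_const.sub (continuousOn_const.div (continuousOn_id.add continuousOn_const)
      fun x hx => by simpa using (by linarith [hx.1] : 0 < x + c).ne')
  have hnonneg : 0 ≤ᵐ[volume.restrict (Icc (0:ℝ) 1)] fun x => 1 - c / (x + c) := by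
    filter_upwards [ae_restrict_mem measurableSet_Icc] with x hx
    have hpos : 0 < x + c := by linarith [hx.1]
    exact sub_nonneg.2 ((div_le_one hpos).2 (by linarith [hx.1]))
  rw [Measure.volume_eq_prod, Measure.prod_apply hmeas, hslice,
    lintegral_indicator measurableSet_Icc,
    ← ofReal_integral_eq_lintegral_ofReal hcont.integrableOn_Icc hnonneg,
    integral_Icc_eq_integral_Ioc, ← intervalIntegral.integral_of_le zero_le_one,
    integral_one_sub_div_add hc0]
end

section
/- The pushforward of the uniform probability measure on [0,1]² under the map (λ,u) ↦ λ·u + (1−u)/2 has density l(a) = log(1/|2a−1|)·1_{(0,1)}(a) with respect to Lebesgue measure on ℝ. -/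
open MeasureTheory Set

theorem lintegral_Icc_comp_contraction_half (g : ℝ → ENNReal) {u : ℝ} (hu : 0 < u) :
    ∫⁻ l in Icc (0:ℝ) 1, g (l * u + (1 - u) / 2)
      = ∫⁻ a, {a : ℝ | |2 * a - 1| ≤ u}.indicator (fun a => ENNReal.ofReal u⁻¹ * g a) a := by
  have himage : (fun l : ℝ => l * u + (1 - u) / 2) '' Icc 0 1 = {a : ℝ | |2 * a - 1| ≤ u} := by
    ext a
    simp only [mem_image, mem_Icc, mem_ofPred_eq, abs_le]
    constructor
    · rintro ⟨l, ⟨h0, h1⟩, rfl⟩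
      constructor <;> nlinarith
    · rintro ⟨h0, h1⟩
      refine ⟨(a - (1 - u) / 2) / u, ⟨div_nonneg (by linarith) hu.le, ?_⟩, by field_simp; ring⟩
      rw [div_le_one hu]
      linarith
  have hmeas : MeasurableSet {a : ℝ | |2 * a - 1| ≤ u} :=
    measurableSet_le (by fun_prop) (by fun_prop)
  rw [lintegral_indicator hmeas, ← himage,
    lintegral_image_eq_lintegral_abs_deriv_mul (f' := fun _ => u) measurableSet_Icc]
  · refine lintegral_congr fun l => ?_
    rw [← mul_assoc, abs_of_pos hu, ← ENNReal.ofReal_mul hu.le, mul_inv_cancel₀ hu.ne',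
      ENNReal.ofReal_one, one_mul]
  · intro l _
    simpa using (((hasDerivAt_id l).mul_const u).add_const ((1 - u) / 2)).hasDerivWithinAt
  · intro x _ y _ hxy
    simpa [hu.ne'] using hxy

theorem lintegral_inv_Icc {c : ℝ} (hc : 0 < c) (hc1 : c ≤ 1) :
    ∫⁻ u in Icc c 1, ENNReal.ofReal u⁻¹ = ENNReal.ofReal (Real.log (1 / c)) := by
  have hint : IntegrableOn (fun u : ℝ => u⁻¹) (Icc c 1) :=
    (continuousOn_id.inv₀ fun u hu => (hc.trans_le hu.1).ne').integrableOn_Icc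
  rw [← ofReal_integral_eq_lintegral_ofReal hint, integral_Icc_eq_integral_Ioc,
    ← intervalIntegral.integral_of_le hc1, integral_inv_of_pos hc one_pos]
  filter_upwards [ae_restrict_mem measurableSet_Icc] with u hu
  exact inv_nonneg.2 (hc.le.trans hu.1)

theorem lintegral_Ioc_indicator_inv {a : ℝ} (ha : a ≠ 1 / 2) :
    ∫⁻ u in Ioc (0:ℝ) 1, (Ici |2 * a - 1|).indicator (fun u => ENNReal.ofReal u⁻¹) u
      = ENNReal.ofReal
          ((Ioo (0:ℝ) 1).indicator (fun a => Real.log (1 / |2 * a - 1|)) a) := by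
  have hpos : 0 < |2 * a - 1| := abs_pos.2 fun h => ha (by linarith)
  have hset : Ici |2 * a - 1| ∩ Ioc 0 1 = Icc |2 * a - 1| 1 := by
    ext u
    exact ⟨fun h => ⟨h.1, h.2.2⟩, fun h => ⟨h.1, hpos.trans_le h.1, h.2⟩⟩
  rw [lintegral_indicator measurableSet_Ici, Measure.restrict_restrict measurableSet_Ici, hset]
  by_cases h : a ∈ Ioo (0:ℝ) 1
  · rw [indicator_of_mem h, lintegral_inv_Icc hpos]
    exact abs_le.2 ⟨by linarith [h.1], by linarith [h.2]⟩
  · have hle : 1 ≤ |2 * a - 1| := by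
      by_contra! hlt
      obtain ⟨h0, h1⟩ := abs_lt.1 hlt
      exact h ⟨by linarith, by linarith⟩
    rw [indicator_of_notMem h, ENNReal.ofReal_zero]
    refine setLIntegral_measure_zero _ _ ?_
    rw [Real.volume_Icc, ENNReal.ofReal_eq_zero]
    linarith

theorem density_of_A' :
    Measure.map (fun p : ℝ × ℝ => p.1 * p.2 + (1 - p.2) / 2)
        (volume.restrict (Icc (0:ℝ) 1 ×ˢ Icc (0:ℝ) 1))
      = volume.withDensity
          (fun a => ENNReal.ofReal
            (Set.indicator (Ioo (0:ℝ) 1) (fun a => Real.log (1 / |2 * a - 1|)) a)) := by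
  have hf : Measurable fun p : ℝ × ℝ => p.1 * p.2 + (1 - p.2) / 2 := by fun_prop
  ext s hs
  set g : ℝ → ENNReal := s.indicator 1 with hg_def
  have hg : Measurable g := measurable_one.indicator hs
  have hne : ∀ᵐ a : ℝ, a ≠ 1 / 2 := Measure.ae_ne volume _
  have hregion : MeasurableSet {p : ℝ × ℝ | |2 * p.2 - 1| ≤ p.1} :=
    measurableSet_le (by fun_prop) (by fun_prop)
  calc Measure.map (fun p : ℝ × ℝ => p.1 * p.2 + (1 - p.2) / 2)
        (volume.restrict (Icc (0:ℝ) 1 ×ˢ Icc (0:ℝ) 1)) s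
      = ∫⁻ p in Icc (0:ℝ) 1 ×ˢ Icc (0:ℝ) 1, g (p.1 * p.2 + (1 - p.2) / 2) := by
        rw [← lintegral_indicator_one hs, lintegral_map hg hf]
    _ = ∫⁻ u in Icc (0:ℝ) 1, ∫⁻ l in Icc (0:ℝ) 1, g (l * u + (1 - u) / 2) := by
        rw [Measure.volume_eq_prod, ← Measure.prod_restrict]
        exact lintegral_prod_symm' _ (hg.comp hf)
    _ = ∫⁻ u in Ioc (0:ℝ) 1, ∫⁻ a,
          {a : ℝ | |2 * a - 1| ≤ u}.indicator (fun a => ENNReal.ofReal u⁻¹ * g a) a := by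
        rw [← setLIntegral_congr Ioc_ae_eq_Icc]
        exact setLIntegral_congr_fun measurableSet_Ioc fun u hu =>
          lintegral_Icc_comp_contraction_half g hu.1
    _ = ∫⁻ a, ∫⁻ u in Ioc (0:ℝ) 1,
          {a : ℝ | |2 * a - 1| ≤ u}.indicator (fun a => ENNReal.ofReal u⁻¹ * g a) a := by
        refine lintegral_lintegral_swap (Measurable.aemeasurable ?_)
        have hm : Measurable fun p : ℝ × ℝ => ENNReal.ofReal p.1⁻¹ * g p.2 := by fun_prop
        exact hm.indicator hregion
    _ = ∫⁻ a, g a * ENNReal.ofReal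
          ((Ioo (0:ℝ) 1).indicator (fun a => Real.log (1 / |2 * a - 1|)) a) := by
        refine lintegral_congr_ae ?_
        filter_upwards [hne] with a ha
        rw [← lintegral_Ioc_indicator_inv ha, ← lintegral_const_mul]
        · simp [indicator, mul_comm]
        · exact Measurable.indicator (by fun_prop) measurableSet_Ici
    _ = _ := by
        rw [withDensity_apply _ hs, ← lintegral_indicator hs]
        refine lintegral_congr fun a => ?_
        by_cases h : a ∈ s <;> simp [hg_def, h]
end

section
/- Let μ be the measure on (0,∞) with density r ↦ √(2/π)·r²·e^{−r²/2} (the law of a three-dimensional Bessel process at time 1 started from 0), and let ν be the measure on (0,1) with density a ↦ log(1/|2a−1|). Then the pushforward of μ ⊗ ν under the map (r,a) ↦ r·a has density x ↦ √(2/π)·x²·∫₁^∞ y·exp(−x²y²/2)·log(1/|2/y − 1|) dy on (0,∞) with respect to Lebesgue measure. -/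
open MeasureTheory Set

open scoped ENNReal

lemma lintegral_Ioo_zero_one_eq_lintegral_Ioi_one_inv (g : ℝ → ℝ≥0∞) :
    ∫⁻ a in Ioo (0:ℝ) 1, g a = ∫⁻ y in Ioi (1:ℝ), ENNReal.ofReal ((y ^ 2)⁻¹) * g y⁻¹ := by
  have himage : (fun y : ℝ => y⁻¹) '' Ioi 1 = Ioo 0 1 := by
    rw [image_inv_eq_inv, inv_Ioi₀ one_pos, inv_one]
  rw [← himage, lintegral_image_eq_lintegral_abs_deriv_mul measurableSet_Ioi
    (fun y hy => (hasDerivAt_inv (zero_lt_one.trans hy).ne').hasDerivWithinAt)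
    inv_injective.injOn]
  refine lintegral_congr fun y => ?_
  rw [abs_neg, abs_of_nonneg (by positivity)]

lemma lintegral_Ioi_zero_comp_mul_right {y : ℝ} (hy : 0 < y) (g : ℝ → ℝ≥0∞) :
    ∫⁻ r in Ioi (0:ℝ), g r = ∫⁻ x in Ioi (0:ℝ), ENNReal.ofReal y * g (x * y) := by
  have himage : (fun x : ℝ => x * y) '' Ioi 0 = Ioi 0 := by
    simp only [mul_comm _ y, image_mul_left_Ioi hy, mul_zero]
  conv_lhs => rw [← himage]
  rw [lintegral_image_eq_lintegral_abs_deriv_mul measurableSet_Ioi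
    (fun x _ => (hasDerivAt_mul_const y).hasDerivWithinAt)
    (mul_left_injective₀ hy.ne').injOn, abs_of_pos hy]

/-- The multiplicative convolution of a density on `(0, ∞)` with a density on `(0, 1)`. -/
lemma map_mul_prod_withDensity {h l : ℝ → ℝ≥0∞} (hh : Measurable h) (hl : Measurable l) :
    Measure.map (fun p : ℝ × ℝ => p.1 * p.2)
        (((volume.restrict (Ioi (0:ℝ))).withDensity h).prod
          ((volume.restrict (Ioo (0:ℝ) 1)).withDensity l))
      = (volume.restrict (Ioi (0:ℝ))).withDensity
          (fun x => ∫⁻ y in Ioi (1:ℝ), ENNReal.ofReal y⁻¹ * (h (x * y) * l y⁻¹)) := by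
  refine Measure.ext_of_lintegral _ fun f hf => ?_
  have hdens : Measurable
      (fun x => ∫⁻ y in Ioi (1:ℝ), ENNReal.ofReal y⁻¹ * (h (x * y) * l y⁻¹)) :=
    Measurable.lintegral_prod_right' (f := fun p : ℝ × ℝ =>
      ENNReal.ofReal p.2⁻¹ * (h (p.1 * p.2) * l p.2⁻¹)) (by fun_prop)
  rw [lintegral_map hf (by fun_prop), prod_withDensity hh hl,
    lintegral_withDensity_eq_lintegral_mul _ (by fun_prop) (by fun_prop),
    lintegral_prod_symm' _ (by fun_prop),
    lintegral_withDensity_eq_lintegral_mul _ hdens hf,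
    lintegral_Ioo_zero_one_eq_lintegral_Ioi_one_inv]
  simp only [Pi.mul_apply]
  have hinner : ∀ x, (∫⁻ y in Ioi (1:ℝ), ENNReal.ofReal y⁻¹ * (h (x * y) * l y⁻¹)) * f x
      = ∫⁻ y in Ioi (1:ℝ), ENNReal.ofReal y⁻¹ * (h (x * y) * l y⁻¹) * f x := fun x =>
    (lintegral_mul_const _ (by fun_prop)).symm
  simp only [hinner]
  rw [lintegral_lintegral_swap (by fun_prop)]
  refine setLIntegral_congr_fun measurableSet_Ioi fun y hy => ?_
  have hy0 : (0:ℝ) < y := zero_lt_one.trans hy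
  rw [lintegral_Ioi_zero_comp_mul_right hy0, ← lintegral_const_mul _ (by fun_prop)]
  refine lintegral_congr fun x => ?_
  rw [mul_inv_cancel_right₀ hy0.ne', ← mul_assoc, ← mul_assoc,
    ← ENNReal.ofReal_mul (by positivity), show (y ^ 2)⁻¹ * y = y⁻¹ by field_simp, mul_assoc,
    mul_assoc]

lemma integrableOn_log_one_div_abs_two_mul_sub_one :
    IntegrableOn (fun a : ℝ => Real.log (1 / |2 * a - 1|)) (Ioo 0 1) := by
  have h : IntervalIntegrable (fun a : ℝ => -Real.log (2 * a - 1)) volume 0 1 := by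
    have := ((intervalIntegral.intervalIntegrable_log' (a := -1) (b := 1)).comp_sub_right
      1).comp_mul_left (c := 2)
    norm_num at this
    exact this.neg
  rw [intervalIntegrable_iff_integrableOn_Ioo_of_le zero_le_one] at h
  simpa using h

lemma lintegral_sq_mul_exp_neg_sq_div_two_lt_top (c : ℝ) :
    ∫⁻ r in Ioi (0:ℝ), ENNReal.ofReal (c * r ^ 2 * Real.exp (-r ^ 2 / 2)) < ∞ := by
  refine Integrable.lintegral_lt_top (Integrable.integrableOn ?_)
  have h := (integrable_rpow_mul_exp_neg_mul_sq (b := 1 / 2) (s := 2) (by norm_num)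
    (by norm_num)).const_mul c
  refine h.congr (.of_forall fun r => ?_)
  simp only [Real.rpow_ofNat, ← mul_assoc]
  ring_nf

lemma ofReal_integral_of_lintegral_ne_top {α : Type*} [MeasurableSpace α] {μ : Measure α}
    {f : α → ℝ} (hf : AEStronglyMeasurable f μ) (hf0 : 0 ≤ᵐ[μ] f)
    (hfin : ∫⁻ a, ENNReal.ofReal (f a) ∂μ ≠ ∞) :
    ∫⁻ a, ENNReal.ofReal (f a) ∂μ = ENNReal.ofReal (∫ a, f a ∂μ) :=
  (ofReal_integral_eq_lintegral_ofReal
    ((lintegral_ofReal_ne_top_iff_integrable hf hf0).1 hfin) hf0).symm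

theorem density_of_R1_A' :
    Measure.map (fun p : ℝ × ℝ => p.1 * p.2)
        (((volume.restrict (Ioi (0:ℝ))).withDensity
            (fun r => ENNReal.ofReal (Real.sqrt (2 / Real.pi) * r ^ 2 *
              Real.exp (-r ^ 2 / 2)))).prod
          ((volume.restrict (Ioo (0:ℝ) 1)).withDensity
            (fun a => ENNReal.ofReal (Real.log (1 / |2 * a - 1|)))))
      = volume.withDensity
          (fun x => ENNReal.ofReal
            (Set.indicator (Ioi (0:ℝ))
              (fun x => Real.sqrt (2 / Real.pi) * x ^ 2 *
                ∫ y in Ioi (1:ℝ),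
                  y * Real.exp (-x ^ 2 * y ^ 2 / 2) * Real.log (1 / |2 / y - 1|)) x)) := by
  set h : ℝ → ℝ≥0∞ := fun r => ENNReal.ofReal (Real.sqrt (2 / Real.pi) * r ^ 2 *
    Real.exp (-r ^ 2 / 2)) with h_def
  set l : ℝ → ℝ≥0∞ := fun a => ENNReal.ofReal (Real.log (1 / |2 * a - 1|)) with l_def
  have hh : Measurable h := by fun_prop
  have hl : Measurable l := by
    have : Measurable fun a : ℝ => |2 * a - 1| := (by fun_prop : Continuous _).measurable
    fun_prop
  have hmap := map_mul_prod_withDensity hh hl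
  set D : ℝ → ℝ≥0∞ := fun x => ∫⁻ y in Ioi (1:ℝ), ENNReal.ofReal y⁻¹ * (h (x * y) * l y⁻¹)
    with D_def
  have hD : Measurable D :=
    Measurable.lintegral_prod_right' (f := fun p : ℝ × ℝ =>
      ENNReal.ofReal p.2⁻¹ * (h (p.1 * p.2) * l p.2⁻¹)) (by fun_prop)
  have hDfin : ∀ᵐ x ∂volume.restrict (Ioi (0:ℝ)), D x < ∞ := by
    have htot := congrArg (fun m => m univ) hmap
    simp only [Measure.map_apply (f := fun p : ℝ × ℝ => p.1 * p.2) (by fun_prop) .univ,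
      preimage_univ, withDensity_apply _ MeasurableSet.univ, Measure.restrict_univ,
      ← univ_prod_univ, Measure.prod_prod] at htot
    refine ae_lt_top hD ?_
    rw [← htot]
    exact ENNReal.mul_ne_top (lintegral_sq_mul_exp_neg_sq_div_two_lt_top _).ne
      integrableOn_log_one_div_abs_two_mul_sub_one.lintegral_lt_top.ne
  have hind : (fun x => ENNReal.ofReal
            (Set.indicator (Ioi (0:ℝ))
              (fun x => Real.sqrt (2 / Real.pi) * x ^ 2 *
                ∫ y in Ioi (1:ℝ),
                  y * Real.exp (-x ^ 2 * y ^ 2 / 2) * Real.log (1 / |2 / y - 1|)) x))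
      = (Ioi (0:ℝ)).indicator (fun x => ENNReal.ofReal (Real.sqrt (2 / Real.pi) * x ^ 2 *
                ∫ y in Ioi (1:ℝ),
                  y * Real.exp (-x ^ 2 * y ^ 2 / 2) * Real.log (1 / |2 / y - 1|))) := by
    ext x
    by_cases hx : x ∈ Ioi (0:ℝ) <;> simp [hx]
  rw [hmap, hind, withDensity_indicator measurableSet_Ioi]
  refine withDensity_congr_ae ?_
  filter_upwards [hDfin, ae_restrict_mem measurableSet_Ioi] with x hxfin hx
  have hlog : ∀ y ∈ Ioi (1:ℝ), 0 ≤ Real.log (1 / |2 / y - 1|) := by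
    intro y hy
    have hy0 : (0:ℝ) < y := zero_lt_one.trans hy
    have h1 : |2 / y - 1| ≤ 1 := by
      have h2 : 2 / y ≤ 2 := (div_le_iff₀ hy0).2 (by linarith [mem_Ioi.1 hy])
      exact abs_le.2 ⟨by linarith [div_pos two_pos hy0], by linarith⟩
    rw [one_div, Real.log_inv]
    exact neg_nonneg.2 (Real.log_nonpos (abs_nonneg _) h1)
  have hDeq : D x = ∫⁻ y in Ioi (1:ℝ), ENNReal.ofReal (Real.sqrt (2 / Real.pi) * x ^ 2 *
      (y * Real.exp (-x ^ 2 * y ^ 2 / 2) * Real.log (1 / |2 / y - 1|))) := by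
    refine setLIntegral_congr_fun measurableSet_Ioi fun y hy => ?_
    have hy0 : (0:ℝ) < y := zero_lt_one.trans hy
    simp only [h_def, l_def]
    rw [← ENNReal.ofReal_mul (by positivity), ← ENNReal.ofReal_mul (by positivity),
      ← div_eq_mul_inv 2 y]
    congr 1
    rw [show -(x * y) ^ 2 / 2 = -x ^ 2 * y ^ 2 / 2 by ring]
    field_simp
  rw [hDeq] at hxfin ⊢
  rw [ofReal_integral_of_lintegral_ne_top _ _ hxfin.ne, integral_const_mul]
  · have : Measurable fun y : ℝ => |2 / y - 1| :=
      continuous_abs.measurable.comp (by fun_prop)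
    exact Measurable.aestronglyMeasurable (by fun_prop)
  · filter_upwards [ae_restrict_mem measurableSet_Ioi] with y hy
    have hy0 : (0:ℝ) < y := zero_lt_one.trans hy
    have := hlog y hy
    simp only [Pi.zero_apply]
    positivity
end

section
/- For every c with 0 < c ≤ 1, one has ∫₀¹ ∫₀^∞ ∫₀^∞ 1_{{λ·l > c·x}} · (2/√(2π))·(x+l)·exp(−(x+l)²/2) dx dl dλ = 1 − c·log(1 + 1/c). -/
open MeasureTheory Set

/-- Integral of the joint density over the section `{x > 0 : c * x < a}`. -/
lemma integral_density_section (k c l a : ℝ) (hc : 0 < c) (ha : 0 ≤ a) :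
    ∫ x in Ioi (0:ℝ), (if c * x < a then k * (x + l) * Real.exp (-(x + l) ^ 2 / 2) else 0)
      = k * (Real.exp (-(l ^ 2 / 2)) - Real.exp (-((a / c + l) ^ 2 / 2))) := by
  have hind : (fun x : ℝ => if c * x < a then k * (x + l) * Real.exp (-(x + l) ^ 2 / 2) else 0)
      = (Iio (a / c)).indicator (fun x => k * (x + l) * Real.exp (-(x + l) ^ 2 / 2)) := by
    funext x
    simp only [indicator, mem_Iio, lt_div_iff₀' hc]
  rw [hind, setIntegral_indicator measurableSet_Iio, Ioi_inter_Iio, ← integral_Ioc_eq_integral_Ioo,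
    ← intervalIntegral.integral_of_le (div_nonneg ha hc.le)]
  have hderiv : ∀ x ∈ uIcc 0 (a / c),
      HasDerivAt (fun x => -k * Real.exp (-(x + l) ^ 2 / 2))
        (k * (x + l) * Real.exp (-(x + l) ^ 2 / 2)) x := by
    intro x _
    have h := ((((((hasDerivAt_id x).add_const l).pow 2).neg).div_const 2).exp).const_mul (-k)
    refine h.congr_deriv ?_
    simp
    ring
  rw [intervalIntegral.integral_eq_sub_of_hasDerivAt hderiv
    (Continuous.intervalIntegrable (by fun_prop) _ _)]
  simp only [zero_add, neg_div]
  ring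

/-- Integral over `(0, ∞)` of the difference of two Gaussians, of scales `1` and `1 / m`. -/
lemma integral_gaussian_sub (m : ℝ) (hm : 0 < m) :
    ∫ l in Ioi (0:ℝ), 2 / Real.sqrt (2 * Real.pi) *
        (Real.exp (-(l ^ 2 / 2)) - Real.exp (-((m * l) ^ 2 / 2)))
      = 1 - 1 / m := by
  have e1 : (fun l : ℝ => Real.exp (-(l ^ 2 / 2))) = fun l => Real.exp (-(1 / 2) * l ^ 2) := by
    funext l; ring_nf
  have e2 : (fun l : ℝ => Real.exp (-((m * l) ^ 2 / 2)))
      = fun l => Real.exp (-(m ^ 2 / 2) * l ^ 2) := by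
    funext l; ring_nf
  have i1 : Integrable fun l : ℝ => Real.exp (-(l ^ 2 / 2)) := by
    rw [e1]; exact integrable_exp_neg_mul_sq (by norm_num)
  have i2 : Integrable fun l : ℝ => Real.exp (-((m * l) ^ 2 / 2)) := by
    rw [e2]; exact integrable_exp_neg_mul_sq (by positivity)
  rw [integral_const_mul, integral_sub i1.integrableOn i2.integrableOn, e1, e2,
    integral_gaussian_Ioi, integral_gaussian_Ioi]
  have h1 : Real.pi / (1 / 2) = 2 * Real.pi := by ring
  have h2 : Real.pi / (m ^ 2 / 2) = 2 * Real.pi / m ^ 2 := by field_simp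
  have hpi : Real.sqrt (2 * Real.pi) ≠ 0 := (Real.sqrt_pos.2 (by positivity)).ne'
  rw [h1, h2, Real.sqrt_div (by positivity), Real.sqrt_sq hm.le]
  field_simp

theorem prob_alpha_c_pos (c : ℝ) (hc0 : 0 < c) (hc1 : c ≤ 1) :
    ∫ lam in (0:ℝ)..1, ∫ l in Ioi (0:ℝ), ∫ x in Ioi (0:ℝ),
        (if c * x < lam * l then
          (2 / Real.sqrt (2 * Real.pi)) * (x + l) * Real.exp (-(x + l) ^ 2 / 2)
        else 0)
      = 1 - c * Real.log (1 + 1 / c) := by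
  have hinner : ∀ lam ∈ uIcc (0:ℝ) 1, (∫ l in Ioi (0:ℝ), ∫ x in Ioi (0:ℝ),
        (if c * x < lam * l then
          (2 / Real.sqrt (2 * Real.pi)) * (x + l) * Real.exp (-(x + l) ^ 2 / 2)
        else 0)) = 1 - c * (1 / (lam + c)) := by
    intro lam hlam
    rw [uIcc_of_le zero_le_one] at hlam
    have hlam0 : 0 ≤ lam := hlam.1
    have hm : 0 < lam / c + 1 := by positivity
    have hne : lam + c ≠ 0 := by positivity
    calc _ = ∫ l in Ioi (0:ℝ), 2 / Real.sqrt (2 * Real.pi) *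
        (Real.exp (-(l ^ 2 / 2)) - Real.exp (-(((lam / c + 1) * l) ^ 2 / 2))) := by
          refine setIntegral_congr_fun measurableSet_Ioi fun l hl => ?_
          have hl0 : 0 < l := hl
          have hsum : lam * l / c + l = (lam / c + 1) * l := by ring
          rw [integral_density_section _ c l (lam * l) hc0 (by positivity), hsum]
      _ = 1 - 1 / (lam / c + 1) := integral_gaussian_sub _ hm
      _ = 1 - c * (1 / (lam + c)) := by
          field_simp
  have hcont : IntervalIntegrable (fun lam : ℝ => c * (1 / (lam + c))) volume 0 1 := by
    refine ContinuousOn.intervalIntegrable ?_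
    rw [uIcc_of_le zero_le_one]
    refine continuousOn_const.mul (continuousOn_const.div (by fun_prop) fun x hx => ?_)
    have := hx.1
    positivity
  have hlog : (c + 1) / c = 1 + 1 / c := by field_simp
  rw [intervalIntegral.integral_congr hinner,
    intervalIntegral.integral_sub intervalIntegrable_const hcont,
    intervalIntegral.integral_const_mul,
    intervalIntegral.integral_comp_add_right (fun x : ℝ => 1 / x), zero_add, add_comm 1 c,
    integral_one_div_of_pos hc0 (by positivity), hlog]
  simp
end

section
/- Let 0 < c ≤ 1. For every x < 0, the density at x of the pushforward under (λ,(y,l)) ↦ λ·l − c·y of the product of the uniform probability measure on [0,1] and the measure on (0,∞)² with density (y,l) ↦ (2/√(2π))·(y+l)·exp(−(y+l)²/2) equals log(1 + 1/c)·√(2/π)·exp(−x²/(2c²)). -/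
open MeasureTheory Set

lemma lintegral_comp_const_sub_mul {c : ℝ} (hc : 0 < c) (b : ℝ) {H : ℝ → ENNReal}
    (hH : Measurable H) :
    ∫⁻ y, H (b - c * y) = ENNReal.ofReal c⁻¹ * ∫⁻ x, H x := by
  have h1 : ∫⁻ y, H (b - y) ∂(Measure.map (c * ·) volume) = ∫⁻ y, H (b - c * y) :=
    lintegral_map (by fun_prop) (by fun_prop)
  rw [← h1, Real.map_volume_mul_left hc.ne', lintegral_smul_measure,
    abs_of_pos (inv_pos.2 hc), lintegral_sub_left_eq_self H b, smul_eq_mul]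

lemma lintegral_Ioi_mul_exp_neg_sq_affine {a m b : ℝ} (ha : 0 ≤ a) (hm : 0 < m) (hb : 0 ≤ b) :
    ∫⁻ l in Ioi (0:ℝ), ENNReal.ofReal (a * (m * l + b) * Real.exp (-(m * l + b) ^ 2 / 2))
      = ENNReal.ofReal (a / m * Real.exp (-b ^ 2 / 2)) := by
  have hderiv : ∀ l ∈ Ici (0:ℝ), HasDerivAt
      (fun l => -(a / m) * Real.exp (-(m * l + b) ^ 2 / 2))
      (a * (m * l + b) * Real.exp (-(m * l + b) ^ 2 / 2)) l := by
    intro l _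
    have h := (((((((hasDerivAt_id l).const_mul m).add_const b).pow 2).neg).div_const 2).exp).const_mul
      (-(a / m))
    refine h.congr_deriv ?_
    simp
    field_simp
  have hnonneg : ∀ l ∈ Ioi (0:ℝ), 0 ≤ a * (m * l + b) * Real.exp (-(m * l + b) ^ 2 / 2) := by
    intro l hl
    have : 0 < l := hl
    positivity
  have hlim : Filter.Tendsto (fun l => -(a / m) * Real.exp (-(m * l + b) ^ 2 / 2))
      Filter.atTop (nhds 0) := by
    rw [← mul_zero (-(a / m))]
    refine Filter.Tendsto.const_mul _ (Real.tendsto_exp_atBot.comp ?_)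
    have h1 : Filter.Tendsto (fun l : ℝ => m * l + b) Filter.atTop Filter.atTop :=
      Filter.tendsto_atTop_add_const_right _ _ (Filter.tendsto_id.const_mul_atTop hm)
    have h2 := ((Filter.tendsto_pow_atTop (α := ℝ) two_ne_zero).comp h1).atTop_div_const
      (zero_lt_two' ℝ)
    refine (Filter.tendsto_neg_atTop_atBot.comp h2).congr fun l => ?_
    simp [neg_div]
  rw [← ofReal_integral_eq_lintegral_ofReal
      (integrableOn_Ioi_deriv_of_nonneg' hderiv hnonneg hlim)
      ((ae_restrict_iff' measurableSet_Ioi).2 (Filter.Eventually.of_forall hnonneg)),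
    integral_Ioi_of_hasDerivAt_of_nonneg' hderiv hnonneg hlim]
  simp

lemma lintegral_Icc_inv_add {c : ℝ} (hc : 0 < c) :
    ∫⁻ t in Icc (0:ℝ) 1, ENNReal.ofReal (t + c)⁻¹ = ENNReal.ofReal (Real.log (1 + 1 / c)) := by
  have hpos : ∀ t ∈ Icc (0:ℝ) 1, 0 < t + c := fun t ht => by linarith [ht.1]
  have hint : IntegrableOn (fun t : ℝ => (t + c)⁻¹) (Icc 0 1) :=
    ContinuousOn.integrableOn_compact isCompact_Icc
      (ContinuousOn.inv₀ (by fun_prop) fun t ht => (hpos t ht).ne')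
  rw [← ofReal_integral_eq_lintegral_ofReal hint
      ((ae_restrict_iff' measurableSet_Icc).2
        (Filter.Eventually.of_forall fun t ht => (inv_pos.2 (hpos t ht)).le)),
    integral_Icc_eq_integral_Ioc, ← intervalIntegral.integral_of_le zero_le_one,
    intervalIntegral.integral_comp_add_right (fun t => t⁻¹),
    integral_inv_of_pos (by linarith) (by linarith)]
  congr 2
  field_simp
  ring

/-- For a density on the positive quadrant depending on `y + l` only, of Rayleigh type, the part
of the law of `t * l - c * y` on the negative half-line is a multiple of a Gaussian measure. -/
lemma withDensity_quadrant_preimage {a c t : ℝ} (ha : 0 ≤ a) (hc : 0 < c) (ht : 0 ≤ t) {S : Set ℝ}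
    (hS : MeasurableSet S) (hneg : S ⊆ Iio (0:ℝ)) :
    ((volume.restrict (Ioi (0:ℝ) ×ˢ Ioi (0:ℝ))).withDensity (fun p => ENNReal.ofReal
        (a * (p.1 + p.2) * Real.exp (-(p.1 + p.2) ^ 2 / 2))))
        ((fun p : ℝ × ℝ => t * p.2 - c * p.1) ⁻¹' S)
      = ENNReal.ofReal (t + c)⁻¹ *
          ∫⁻ x in S, ENNReal.ofReal (a * Real.exp (-x ^ 2 / (2 * c ^ 2))) := by
  have hT : MeasurableSet ((fun p : ℝ × ℝ => t * p.2 - c * p.1) ⁻¹' S) :=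
    (show Measurable fun p : ℝ × ℝ => t * p.2 - c * p.1 by fun_prop) hS
  have hslice : ∀ l ∈ Ioi (0:ℝ), ∫⁻ y in Ioi (0:ℝ),
      ((fun p : ℝ × ℝ => t * p.2 - c * p.1) ⁻¹' S).indicator (fun p => ENNReal.ofReal
        (a * (p.1 + p.2) * Real.exp (-(p.1 + p.2) ^ 2 / 2))) (y, l)
      = ENNReal.ofReal c⁻¹ * ∫⁻ x in S, ENNReal.ofReal
          (a * ((t + c) / c * l + -x / c) * Real.exp (-((t + c) / c * l + -x / c) ^ 2 / 2)) := by
    intro l hl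
    have hl : 0 < l := hl
    rw [← lintegral_indicator hS, ← lintegral_comp_const_sub_mul hc (t * l)
      ((by fun_prop : Measurable _).indicator hS), ← lintegral_indicator measurableSet_Ioi]
    refine lintegral_congr fun y => ?_
    by_cases hy : t * l - c * y ∈ S
    · have hy0 : 0 < y := by
        have h1 : t * l - c * y < 0 := hneg hy
        have h2 : 0 ≤ t * l := by positivity
        exact pos_of_mul_pos_right (by linarith : 0 < c * y) hc.le
      have hu : (t + c) / c * l + -(t * l - c * y) / c = y + l := by field_simp; ring
      simp only [indicator, mem_preimage, mem_Ioi, hy, hy0, if_true, hu]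
    · simp [indicator, hy]
  rw [withDensity_apply _ hT, ← lintegral_indicator hT, Measure.volume_eq_prod,
    ← Measure.prod_restrict, lintegral_prod_symm' _ ((by fun_prop : Measurable _).indicator hT),
    setLIntegral_congr_fun measurableSet_Ioi hslice,
    lintegral_const_mul' _ _ ENNReal.ofReal_ne_top,
    lintegral_lintegral_swap (by fun_prop),
    ← lintegral_const_mul' _ _ ENNReal.ofReal_ne_top,
    ← lintegral_const_mul' _ _ ENNReal.ofReal_ne_top]
  refine setLIntegral_congr_fun hS fun x hx => ?_
  have hx : x < 0 := hneg hx
  have htc : 0 < t + c := by linarith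
  rw [lintegral_Ioi_mul_exp_neg_sq_affine ha (div_pos htc hc) (div_nonneg (by linarith) hc.le),
    ← ENNReal.ofReal_mul (inv_pos.2 hc).le, ← ENNReal.ofReal_mul (inv_pos.2 htc).le]
  have he : -(-x / c) ^ 2 / 2 = -x ^ 2 / (2 * c ^ 2) := by field_simp
  rw [he]
  congr 1
  field_simp

theorem density_alpha_c_negative_part (c : ℝ) (hc0 : 0 < c) (hc1 : c ≤ 1) :
    ∀ S : Set ℝ, MeasurableSet S → S ⊆ Iio (0:ℝ) →
      Measure.map (fun q : ℝ × (ℝ × ℝ) => q.1 * q.2.2 - c * q.2.1)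
          ((volume.restrict (Icc (0:ℝ) 1)).prod
            ((volume.restrict (Ioi (0:ℝ) ×ˢ Ioi (0:ℝ))).withDensity
              (fun p => ENNReal.ofReal
                ((2 / Real.sqrt (2 * Real.pi)) * (p.1 + p.2) *
                  Real.exp (-(p.1 + p.2) ^ 2 / 2))))) S
        = ∫⁻ x in S, ENNReal.ofReal
            (Real.log (1 + 1 / c) * Real.sqrt (2 / Real.pi) *
              Real.exp (-x ^ 2 / (2 * c ^ 2))) := by
  intro S hS hneg
  have hF : Measurable (fun q : ℝ × (ℝ × ℝ) => q.1 * q.2.2 - c * q.2.1) := by fun_prop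
  have hconst : 2 / Real.sqrt (2 * Real.pi) = Real.sqrt (2 / Real.pi) := by
    rw [Real.sqrt_mul zero_le_two, Real.sqrt_div zero_le_two, ← div_div, Real.div_sqrt]
  have hlog : 0 ≤ Real.log (1 + 1 / c) :=
    Real.log_nonneg (le_add_of_nonneg_right (one_div_pos.2 hc0).le)
  have hslice := fun (t : ℝ) (ht : t ∈ Icc (0:ℝ) 1) => withDensity_quadrant_preimage
    (by positivity : 0 ≤ 2 / Real.sqrt (2 * Real.pi)) hc0 ht.1 hS hneg
  rw [Measure.map_apply hF hS, Measure.prod_apply (hF hS)]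
  simp only [preimage_preimage]
  rw [setLIntegral_congr_fun measurableSet_Icc hslice,
    lintegral_mul_const _ (by fun_prop), lintegral_Icc_inv_add hc0,
    ← lintegral_const_mul' _ _ ENNReal.ofReal_ne_top, hconst]
  refine lintegral_congr fun x => ?_
  rw [← ENNReal.ofReal_mul hlog, mul_assoc]
end

section
/- Let 0 < c ≤ 1 and set C = 1/c. For every x > 0, the density at x of the pushforward under (λ,(y,l)) ↦ λ·l − c·y of the product of the uniform probability measure on [0,1] and the measure on (0,∞)² with density (y,l) ↦ (2/√(2π))·(y+l)·exp(−(y+l)²/2) equals √(2/π)·∫₀¹ exp(−x²/(2z²))·( C/(1+Cz) ) dz. -/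
open MeasureTheory Set

lemma integrableOn_mul_gaussian_of_abs_le {x M : ℝ} {w : ℝ → ℝ}
    (hw : Measurable w) (hM : ∀ s, x < s → |w s| ≤ M) :
    IntegrableOn (fun s => w s * Real.exp (-s ^ 2 / 2)) (Ioi x) := by
  have h := (integrable_exp_neg_mul_sq (b := 1 / 2) (by norm_num)).integrableOn (s := Ioi x)
  refine Integrable.mono' (h.const_mul M) (by fun_prop) ?_
  filter_upwards [ae_restrict_mem measurableSet_Ioi] with s hs
  have e : -s ^ 2 / 2 = -(1 / 2) * s ^ 2 := by ring
  rw [Real.norm_eq_abs, abs_mul, Real.abs_exp, e]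
  exact mul_le_mul_of_nonneg_right (hM s hs) (Real.exp_pos _).le

lemma integrableOn_inv_mul_gaussian {x : ℝ} (hx : 0 < x) :
    IntegrableOn (fun l => l⁻¹ * Real.exp (-l ^ 2 / 2)) (Ioi x) :=
  integrableOn_mul_gaussian_of_abs_le (M := x⁻¹) (by fun_prop) fun s hs => by
    rw [abs_inv, abs_of_pos (hx.trans hs)]
    exact inv_anti₀ hx hs.le

lemma integrableOn_inv_mul_exp_affine {c x : ℝ} (hc : 0 < c) (hx : 0 < x) :
    IntegrableOn (fun l => l⁻¹ * Real.exp (-((l - x) / c + l) ^ 2 / 2)) (Ioi x) := by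
  have h := integrableOn_inv_mul_gaussian hx
  refine Integrable.mono' h (by fun_prop) ?_
  filter_upwards [ae_restrict_mem measurableSet_Ioi] with l hl
  have hl : x < l := hl
  have hl0 : 0 < l := hx.trans hl
  rw [Real.norm_eq_abs, abs_mul, Real.abs_exp, abs_of_pos (inv_pos.2 hl0)]
  have : 0 ≤ (l - x) / c := div_nonneg (by linarith) hc.le
  gcongr
  linarith

lemma integral_inv_mul_exp_affine {c x : ℝ} (hc : 0 < c) (hx : 0 < x) :
    ∫ l in Ioi x, l⁻¹ * Real.exp (-((l - x) / c + l) ^ 2 / 2)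
      = ∫ s in Ioi x, c / (x + c * s) * Real.exp (-s ^ 2 / 2) := by
  have him : (fun s : ℝ => (x + c * s) / (1 + c)) '' Ioi x = Ioi x := by
    ext l
    simp only [mem_image, mem_Ioi]
    constructor
    · rintro ⟨s, hs, rfl⟩
      rw [lt_div_iff₀ (by linarith)]
      nlinarith
    · intro hl
      refine ⟨((1 + c) * l - x) / c, ?_, ?_⟩
      · rw [lt_div_iff₀ hc]; nlinarith
      · field_simp
        ring
  have hd : ∀ s ∈ Ioi x, HasDerivWithinAt (fun s : ℝ => (x + c * s) / (1 + c))
      (c / (1 + c)) (Ioi x) s := fun s _ => by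
    have := ((((hasDerivAt_id s).const_mul c).const_add x).div_const (1 + c)).hasDerivWithinAt
      (s := Ioi x)
    simpa using this
  have hinj : InjOn (fun s : ℝ => (x + c * s) / (1 + c)) (Ioi x) := by
    intro a _ b _ hab
    have h1 : (1 + c) ≠ 0 := by positivity
    simp only at hab
    field_simp at hab
    have : c * a = c * b := by linarith
    exact mul_left_cancel₀ hc.ne' this
  have key := integral_image_eq_integral_abs_deriv_smul measurableSet_Ioi hd hinj
    (fun l => l⁻¹ * Real.exp (-((l - x) / c + l) ^ 2 / 2))
  rw [him] at key
  rw [key]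
  refine setIntegral_congr_fun measurableSet_Ioi fun s hs => ?_
  have hs : x < s := hs
  have h1 : 0 < x + c * s := by nlinarith [mul_pos hc (hx.trans hs)]
  have e : ((x + c * s) / (1 + c) - x) / c + (x + c * s) / (1 + c) = s := by
    field_simp
    ring
  simp only [e, smul_eq_mul]
  rw [abs_of_pos (by positivity)]
  field_simp

lemma integral_exp_div_sq_mul {c x : ℝ} (hc : 0 < c) (hx : 0 < x) :
    ∫ z in (0 : ℝ)..1, Real.exp (-x ^ 2 / (2 * z ^ 2)) * ((1 / c) / (1 + (1 / c) * z))
      = ∫ s in Ioi x, (s⁻¹ - c / (x + c * s)) * Real.exp (-s ^ 2 / 2) := by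
  have him : (fun s : ℝ => x / s) '' Ioi x = Ioo 0 1 := by
    ext z
    simp only [mem_image, mem_Ioi, mem_Ioo]
    constructor
    · rintro ⟨s, hs, rfl⟩
      have := hx.trans hs
      exact ⟨by positivity, by rwa [div_lt_one this]⟩
    · rintro ⟨h0, h1⟩
      refine ⟨x / z, ?_, by field_simp⟩
      rw [lt_div_iff₀ h0]; nlinarith
  have hd : ∀ s ∈ Ioi x, HasDerivWithinAt (fun s : ℝ => x / s) (-(x / s ^ 2)) (Ioi x) s := by
    intro s hs
    have hs0 : s ≠ 0 := (hx.trans hs).ne'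
    have := ((hasDerivAt_inv hs0).const_mul x).hasDerivWithinAt (s := Ioi x)
    simpa [div_eq_mul_inv] using this
  have hinj : InjOn (fun s : ℝ => x / s) (Ioi x) := by
    intro a ha b hb hab
    have ha0 : a ≠ 0 := (hx.trans ha).ne'
    have hb0 : b ≠ 0 := (hx.trans hb).ne'
    simp only at hab
    field_simp at hab
    exact hab.symm
  have key := integral_image_eq_integral_abs_deriv_smul measurableSet_Ioi hd hinj
    (fun z => Real.exp (-x ^ 2 / (2 * z ^ 2)) * ((1 / c) / (1 + (1 / c) * z)))
  rw [him] at key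
  rw [intervalIntegral.integral_of_le zero_le_one, integral_Ioc_eq_integral_Ioo, key]
  refine setIntegral_congr_fun measurableSet_Ioi fun s hs => ?_
  have hs0 : 0 < s := hx.trans hs
  have e : -x ^ 2 / (2 * (x / s) ^ 2) = -s ^ 2 / 2 := by field_simp
  simp only [e, smul_eq_mul, abs_neg]
  rw [abs_of_pos (by positivity)]
  have : x + c * s ≠ 0 := by positivity
  have : c * s + x ≠ 0 := by positivity
  field_simp
  ring

lemma integral_inv_mul_sub_exp {c x : ℝ} (hc : 0 < c) (hx : 0 < x) :
    ∫ l in Ioi x, l⁻¹ * (Real.exp (-l ^ 2 / 2) - Real.exp (-((l - x) / c + l) ^ 2 / 2))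
      = ∫ z in (0 : ℝ)..1, Real.exp (-x ^ 2 / (2 * z ^ 2)) * ((1 / c) / (1 + (1 / c) * z)) := by
  have h1 := integrableOn_inv_mul_gaussian hx
  have h2 := integrableOn_mul_gaussian_of_abs_le (x := x) (M := c / x)
    (w := fun s => c / (x + c * s)) (by fun_prop) (fun s hs => by
      have hs0 : 0 < c * s := mul_pos hc (hx.trans hs)
      rw [abs_of_pos (by positivity)]
      gcongr
      linarith)
  simp only [integral_exp_div_sq_mul hc hx, mul_sub, sub_mul]
  rw [integral_sub h1 (integrableOn_inv_mul_exp_affine hc hx), integral_sub h1 h2,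
    integral_inv_mul_exp_affine hc hx]

lemma integral_add_mul_exp_neg_sq (l b : ℝ) :
    ∫ y in (0 : ℝ)..b, (y + l) * Real.exp (-(y + l) ^ 2 / 2)
      = Real.exp (-l ^ 2 / 2) - Real.exp (-(b + l) ^ 2 / 2) := by
  have hd : ∀ y ∈ uIcc 0 b, HasDerivAt (fun y => -Real.exp (-(y + l) ^ 2 / 2))
      ((y + l) * Real.exp (-(y + l) ^ 2 / 2)) y := fun y _ => by
    have := (((((hasDerivAt_id y).add_const l).pow 2).neg.div_const 2).exp).neg
    refine this.congr_deriv ?_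
    simp
    ring
  rw [intervalIntegral.integral_eq_sub_of_hasDerivAt hd
    (Continuous.intervalIntegrable (by fun_prop) _ _)]
  simp
  ring

lemma lintegral_Ioi_density_section {c x l k : ℝ} (hc : 0 < c) (hl : 0 < l)
    (hk : 0 ≤ k) :
    ∫⁻ y in Ioi (0 : ℝ), ENNReal.ofReal (k * (y + l) * Real.exp (-(y + l) ^ 2 / 2)) *
        (ENNReal.ofReal l⁻¹ * (Iic (l - c * y)).indicator 1 x)
      = (Ioi x).indicator (fun l => ENNReal.ofReal (k * (l⁻¹ *
          (Real.exp (-l ^ 2 / 2) - Real.exp (-((l - x) / c + l) ^ 2 / 2))))) l := by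
  have hcongr : ∀ y ∈ Ioi (0 : ℝ),
      ENNReal.ofReal (k * (y + l) * Real.exp (-(y + l) ^ 2 / 2)) *
        (ENNReal.ofReal l⁻¹ * (Iic (l - c * y)).indicator 1 x)
      = (Iic ((l - x) / c)).indicator (fun y => ENNReal.ofReal
          (k * l⁻¹ * ((y + l) * Real.exp (-(y + l) ^ 2 / 2)))) y := by
    intro y hy
    have hy : 0 < y := hy
    have hiff : x ≤ l - c * y ↔ y ≤ (l - x) / c := by
      rw [le_div_iff₀ hc]; constructor <;> intro h <;> linarith
    by_cases h : x ≤ l - c * y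
    · rw [indicator_of_mem (mem_Iic.2 h), indicator_of_mem (mem_Iic.2 (hiff.1 h))]
      rw [Pi.one_apply, mul_one, ← ENNReal.ofReal_mul (by positivity)]
      congr 1
      ring
    · rw [indicator_of_notMem (by simpa using h), indicator_of_notMem
        (show y ∉ Iic ((l - x) / c) from fun h' => h (hiff.2 h'))]
      simp
  rw [setLIntegral_congr_fun measurableSet_Ioi hcongr, lintegral_indicator measurableSet_Iic,
    Measure.restrict_restrict measurableSet_Iic, inter_comm, Ioi_inter_Iic]
  by_cases hxl : x < l
  · have hb : 0 ≤ (l - x) / c := div_nonneg (by linarith) hc.le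
    rw [indicator_of_mem (mem_Ioi.2 hxl), ← ofReal_integral_eq_lintegral_ofReal,
      ← intervalIntegral.integral_of_le hb, intervalIntegral.integral_const_mul,
      integral_add_mul_exp_neg_sq, mul_assoc]
    · exact (Continuous.integrableOn_Icc (by fun_prop)).mono_set Ioc_subset_Icc_self
    · filter_upwards [ae_restrict_mem measurableSet_Ioc] with y hy
      have := hy.1
      simp only [Pi.zero_apply]
      positivity
  · rw [indicator_of_notMem (by simpa using hxl), Ioc_eq_empty]
    · simp
    · rw [not_lt]
      exact div_nonpos_of_nonpos_of_nonneg (by linarith [not_lt.1 hxl]) hc.le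

lemma lintegral_quadrant_density_section {c x k : ℝ} (hc : 0 < c) (hx : 0 < x) (hk : 0 ≤ k) :
    ∫⁻ p in Ioi (0 : ℝ) ×ˢ Ioi (0 : ℝ),
        ENNReal.ofReal (k * (p.1 + p.2) * Real.exp (-(p.1 + p.2) ^ 2 / 2)) *
        (ENNReal.ofReal p.2⁻¹ * (Iic (p.2 - c * p.1)).indicator 1 x)
      = ENNReal.ofReal (k * ∫ z in (0 : ℝ)..1,
          Real.exp (-x ^ 2 / (2 * z ^ 2)) * ((1 / c) / (1 + (1 / c) * z))) := by
  have hm : Measurable fun p : ℝ × ℝ =>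
      ENNReal.ofReal (k * (p.1 + p.2) * Real.exp (-(p.1 + p.2) ^ 2 / 2)) *
        (ENNReal.ofReal p.2⁻¹ * (Iic (p.2 - c * p.1)).indicator (1 : ℝ → ENNReal) x) := by
    have : Measurable fun p : ℝ × ℝ => (Iic (p.2 - c * p.1)).indicator (1 : ℝ → ENNReal) x :=
      (measurable_const (a := (1 : ENNReal))).indicator
        (s := {p : ℝ × ℝ | x ≤ p.2 - c * p.1}) (measurableSet_le (by fun_prop) (by fun_prop))
    fun_prop
  rw [Measure.volume_eq_prod, ← Measure.prod_restrict, lintegral_prod_symm _ hm.aemeasurable,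
    setLIntegral_congr_fun measurableSet_Ioi
      (fun l hl => lintegral_Ioi_density_section hc hl hk),
    lintegral_indicator measurableSet_Ioi, Measure.restrict_restrict measurableSet_Ioi,
    inter_eq_left.2 (Ioi_subset_Ioi hx.le), ← integral_inv_mul_sub_exp hc hx,
    ← integral_const_mul, ofReal_integral_eq_lintegral_ofReal]
  · have h1 := integrableOn_inv_mul_gaussian hx
    refine ((h1.sub (integrableOn_inv_mul_exp_affine hc hx)).const_mul k).congr
      (.of_forall fun l => ?_)
    simp only [Pi.sub_apply, mul_sub]
  · filter_upwards [ae_restrict_mem measurableSet_Ioi] with l hl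
    have hl : x < l := hl
    have hl0 : 0 < l := hx.trans hl
    have : 0 ≤ (l - x) / c := div_nonneg (by linarith) hc.le
    have hle : Real.exp (-((l - x) / c + l) ^ 2 / 2) ≤ Real.exp (-l ^ 2 / 2) := by
      gcongr
      linarith
    have := sub_nonneg.2 hle
    simp only [Pi.zero_apply]
    positivity

lemma volume_Icc_preimage_affine {S : Set ℝ} (hS : MeasurableSet S) (hS0 : S ⊆ Ioi 0)
    {l a : ℝ} (hl : 0 < l) (ha : 0 ≤ a) :
    volume.restrict (Icc (0 : ℝ) 1) {u : ℝ | u * l - a ∈ S}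
      = ENNReal.ofReal l⁻¹ * ∫⁻ x in S, (Iic (l - a)).indicator 1 x := by
  have hset : {u : ℝ | u * l - a ∈ S} ∩ Icc 0 1
      = (fun u => u * l) ⁻¹' ((fun v => v + -a) ⁻¹' (Iic (l - a) ∩ S)) := by
    ext u
    simp only [mem_inter_iff, mem_ofPred_eq, mem_Icc, mem_preimage, mem_Iic, ← sub_eq_add_neg]
    constructor
    · rintro ⟨h, -, h1⟩
      exact ⟨by nlinarith, h⟩
    · rintro ⟨h1, h⟩
      have h0 : 0 < u * l - a := hS0 h
      refine ⟨h, ?_, ?_⟩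
      · exact (pos_of_mul_pos_left (by linarith : 0 < u * l) hl.le).le
      · exact le_of_mul_le_mul_right (by linarith) hl
  have hm : MeasurableSet {u : ℝ | u * l - a ∈ S} := hS.preimage (by fun_prop)
  rw [Measure.restrict_apply hm, hset, Real.volume_preimage_mul_right hl.ne',
    measure_preimage_add_right, lintegral_indicator_one measurableSet_Iic,
    Measure.restrict_apply measurableSet_Iic, abs_of_pos (inv_pos.2 hl)]

theorem density_alpha_c_positive_part (c : ℝ) (hc0 : 0 < c) (hc1 : c ≤ 1) :
    ∀ S : Set ℝ, MeasurableSet S → S ⊆ Ioi (0:ℝ) →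
      Measure.map (fun q : ℝ × (ℝ × ℝ) => q.1 * q.2.2 - c * q.2.1)
          ((volume.restrict (Icc (0:ℝ) 1)).prod
            ((volume.restrict (Ioi (0:ℝ) ×ˢ Ioi (0:ℝ))).withDensity
              (fun p => ENNReal.ofReal
                ((2 / Real.sqrt (2 * Real.pi)) * (p.1 + p.2) *
                  Real.exp (-(p.1 + p.2) ^ 2 / 2))))) S
        = ∫⁻ x in S, ENNReal.ofReal
            (Real.sqrt (2 / Real.pi) *
              ∫ z in (0:ℝ)..1,
                Real.exp (-x ^ 2 / (2 * z ^ 2)) * ((1 / c) / (1 + (1 / c) * z))) := by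
  intro S hS hS0
  have hk : 2 / Real.sqrt (2 * Real.pi) = Real.sqrt (2 / Real.pi) := by
    rw [Real.sqrt_div zero_le_two, Real.sqrt_mul zero_le_two, ← div_div, Real.div_sqrt]
  rw [hk]
  set k := Real.sqrt (2 / Real.pi)
  have hT : Measurable fun q : ℝ × (ℝ × ℝ) => q.1 * q.2.2 - c * q.2.1 := by fun_prop
  have hf : Measurable fun p : ℝ × ℝ =>
      ENNReal.ofReal (k * (p.1 + p.2) * Real.exp (-(p.1 + p.2) ^ 2 / 2)) := by fun_prop
  have hI : Measurable fun r : (ℝ × ℝ) × ℝ =>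
      (Iic (r.1.2 - c * r.1.1)).indicator (1 : ℝ → ENNReal) r.2 :=
    (measurable_const (a := (1 : ENNReal))).indicator
      (s := {r : (ℝ × ℝ) × ℝ | r.2 ≤ r.1.2 - c * r.1.1})
      (measurableSet_le (by fun_prop) (by fun_prop))
  rw [Measure.map_apply hT hS, Measure.prod_apply_symm (hT hS),
    lintegral_withDensity_eq_lintegral_mul _ hf (measurable_measure_prodMk_right (hT hS))]
  have hcongr : ∀ p ∈ Ioi (0 : ℝ) ×ˢ Ioi (0 : ℝ),
      ENNReal.ofReal (k * (p.1 + p.2) * Real.exp (-(p.1 + p.2) ^ 2 / 2)) *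
        volume.restrict (Icc (0 : ℝ) 1) {u : ℝ | u * p.2 - c * p.1 ∈ S}
      = ∫⁻ x in S, ENNReal.ofReal (k * (p.1 + p.2) * Real.exp (-(p.1 + p.2) ^ 2 / 2)) *
        (ENNReal.ofReal p.2⁻¹ * (Iic (p.2 - c * p.1)).indicator 1 x) := by
    rintro p ⟨hy, hl⟩
    have hind : Measurable ((Iic (p.2 - c * p.1)).indicator (1 : ℝ → ENNReal)) :=
      measurable_one.indicator measurableSet_Iic
    rw [volume_Icc_preimage_affine hS hS0 hl (mul_pos hc0 hy).le,
      lintegral_const_mul _ (hind.const_mul _), lintegral_const_mul _ hind]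
  refine (setLIntegral_congr_fun (measurableSet_Ioi.prod measurableSet_Ioi) hcongr).trans ?_
  rw [lintegral_lintegral_swap (by unfold Function.uncurry; fun_prop)]
  exact setLIntegral_congr_fun hS fun x hx =>
    lintegral_quadrant_density_section hc0 (hS0 hx) (Real.sqrt_nonneg _)
end
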